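/- For every integer k ≥ 2 and every real number N > k(k+1) − 2, there exist at least 2(k−2)+2 pairwise distinct functions u ∈ C²([0,∞)) with u'(0)=0 satisfying u''(r) + u'(r)/r + (1+r²)^N e^{2u(r)} = 0 on (0,∞) and ∫₀^∞ (1+r²)^N e^{2u(r)} r dr = N+2, one of which is the explicit solution u*_N(r) := (1/2) log( 2(N+2) / (1+r²)^{N+2} ). -/

import Mathlib

open Real Set MeasureTheory Filter

noncomputable section

/-- The explicit solution `u*_N(r) = ½ log( 2(N+2) / (1+r²)^{N+2} )`. -/
def ustar (N : ℝ) (r : ℝ) : ℝ := (1 / 2) * Real.log (2 * (N + 2) / (1 + r ^ 2) ^ (N + 2))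

/-- `u` is a radial solution of `u'' + u'/r + (1+r²)^N e^{2u} = 0` on `(0,∞)`, of
class `C²` on `[0,∞)`, with `u'(0) = 0` and `∫₀^∞ (1+r²)^N e^{2u} r dr = N+2`. -/
def IsSolLevelN2 (N : ℝ) (u : ℝ → ℝ) : Prop :=
  ContDiffOn ℝ 2 u (Ici 0) ∧ derivWithin u (Ici 0) 0 = 0 ∧
  (∀ r : ℝ, 0 < r →
    deriv (deriv u) r + deriv u r / r + (1 + r ^ 2) ^ N * Real.exp (2 * u r) = 0) ∧
  IntegrableOn (fun r => (1 + r ^ 2) ^ N * Real.exp (2 * u r) * r) (Ioi 0) ∧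
  (∫ r in Ioi (0:ℝ), (1 + r ^ 2) ^ N * Real.exp (2 * u r) * r) = N + 2

/-- The nonlinearity `m (1+x)^{m-2} e^u`, with the exponential cut off at level `A`. -/
def cutoffNonlin (m A x u : ℝ) : ℝ := m * (1 + |x|) ^ (m - 2) * Real.exp (min u A)

/-- The mean over `[0, s]` of the cut-off nonlinearity along `φ`. -/
def rayAvg (m A : ℝ) (φ : ℝ → ℝ) (s : ℝ) : ℝ :=
  ∫ θ in (0 : ℝ)..1, cutoffNonlin m A (s * θ) (φ (s * θ))

/-- The weight which makes the integral operator a contraction. -/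
def growthWeight (m A x : ℝ) : ℝ :=
  Real.exp (2 * (m * Real.exp A) / (m - 1) * (1 + |x|) ^ (m - 1))

lemma one_add_abs_pos (x : ℝ) : 0 < 1 + |x| := by positivity

lemma continuous_one_add_abs_rpow (p : ℝ) : Continuous fun x : ℝ => (1 + |x|) ^ p :=
  (continuous_const.add continuous_abs).rpow_const fun x => Or.inl (one_add_abs_pos x).ne'

lemma continuous_cutoffNonlin (m A : ℝ) :
    Continuous fun p : ℝ × ℝ => cutoffNonlin m A p.1 p.2 := by
  unfold cutoffNonlin
  exact (continuous_const.mul ((continuous_one_add_abs_rpow _).comp continuous_fst)).mul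
    (Real.continuous_exp.comp (continuous_snd.min continuous_const))

lemma continuous_growthWeight (m A : ℝ) : Continuous (growthWeight m A) := by
  unfold growthWeight
  exact Real.continuous_exp.comp (continuous_const.mul (continuous_one_add_abs_rpow _))

lemma growthWeight_pos (m A x : ℝ) : 0 < growthWeight m A x := Real.exp_pos _

lemma one_le_growthWeight {m : ℝ} (hm : 2 < m) (A x : ℝ) : 1 ≤ growthWeight m A x := by
  unfold growthWeight
  apply Real.one_le_exp
  have : 0 < m - 1 := by linarith
  have := Real.exp_pos A
  have := one_add_abs_pos x
  positivity

lemma growthWeight_mono {m : ℝ} (hm : 2 < m) (A : ℝ) {x y : ℝ} (h : |x| ≤ |y|) :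
    growthWeight m A x ≤ growthWeight m A y := by
  unfold growthWeight
  apply Real.exp_le_exp.2
  have h1 : 0 < m - 1 := by linarith
  have := Real.exp_pos A
  apply mul_le_mul_of_nonneg_left _ (by positivity)
  exact Real.rpow_le_rpow (one_add_abs_pos x).le (by linarith) h1.le

lemma continuous_rayAvg (m A : ℝ) {φ : ℝ → ℝ} (hφ : Continuous φ) :
    Continuous (rayAvg m A φ) := by
  unfold rayAvg
  apply intervalIntegral.continuous_parametric_intervalIntegral_of_continuous'
  have h : Continuous fun p : ℝ × ℝ => p.1 * p.2 := continuous_mul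
  exact (continuous_cutoffNonlin m A).comp (h.prodMk (hφ.comp h))

lemma abs_mul_le_of_mem_uIoc {s θ : ℝ} (hθ : θ ∈ uIoc (0 : ℝ) 1) : |s * θ| ≤ |s| := by
  rw [uIoc_of_le zero_le_one] at hθ
  rw [abs_mul, abs_of_pos hθ.1]
  exact mul_le_of_le_one_right (abs_nonneg _) hθ.2

lemma abs_cutoffNonlin_le {m : ℝ} (hm : 2 < m) (A : ℝ) {x y : ℝ} (h : |x| ≤ |y|) (u : ℝ) :
    |cutoffNonlin m A x u| ≤ m * Real.exp A * (1 + |y|) ^ (m - 2) := by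
  unfold cutoffNonlin
  have hx := one_add_abs_pos x
  rw [abs_of_nonneg (by positivity)]
  have h1 : (1 + |x|) ^ (m - 2) ≤ (1 + |y|) ^ (m - 2) :=
    Real.rpow_le_rpow hx.le (by linarith) (by linarith)
  have h2 : Real.exp (min u A) ≤ Real.exp A := Real.exp_le_exp.2 (min_le_right _ _)
  calc m * (1 + |x|) ^ (m - 2) * Real.exp (min u A)
      ≤ m * (1 + |y|) ^ (m - 2) * Real.exp A := by gcongr
    _ = _ := by ring

lemma abs_rayAvg_le {m : ℝ} (hm : 2 < m) (A : ℝ) (φ : ℝ → ℝ) (s : ℝ) :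
    |rayAvg m A φ s| ≤ m * Real.exp A * (1 + |s|) ^ (m - 2) := by
  have := intervalIntegral.norm_integral_le_of_norm_le_const (a := 0) (b := 1)
    (f := fun θ => cutoffNonlin m A (s * θ) (φ (s * θ)))
    (C := m * Real.exp A * (1 + |s|) ^ (m - 2))
    (fun θ hθ => abs_cutoffNonlin_le hm A (abs_mul_le_of_mem_uIoc hθ) _)
  simpa [rayAvg] using this

lemma abs_exp_sub_exp_le {p q A : ℝ} (hp : p ≤ A) (hq : q ≤ A) :
    |Real.exp p - Real.exp q| ≤ Real.exp A * |p - q| := by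
  wlog h : q ≤ p generalizing p q
  · rw [abs_sub_comm, abs_sub_comm p q]
    exact this hq hp (by linarith)
  rw [abs_of_nonneg (sub_nonneg.2 (Real.exp_le_exp.2 h)), abs_of_nonneg (by linarith)]
  have h1 := Real.add_one_le_exp (q - p)
  have h2 : Real.exp q = Real.exp p * Real.exp (q - p) := by rw [← Real.exp_add]; ring_nf
  have h3 := Real.exp_le_exp.2 hp
  calc Real.exp p - Real.exp q = Real.exp p * (1 - Real.exp (q - p)) := by rw [h2]; ring
    _ ≤ Real.exp p * (p - q) := mul_le_mul_of_nonneg_left (by linarith) (Real.exp_pos p).le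
    _ ≤ _ := mul_le_mul_of_nonneg_right h3 (by linarith)

lemma abs_cutoffNonlin_sub_le {m : ℝ} (hm : 2 < m) (A : ℝ) {x y : ℝ} (h : |x| ≤ |y|) (u v : ℝ) :
    |cutoffNonlin m A x u - cutoffNonlin m A x v|
      ≤ m * Real.exp A * (1 + |y|) ^ (m - 2) * |u - v| := by
  unfold cutoffNonlin
  have hx := one_add_abs_pos x
  rw [← mul_sub, abs_mul, abs_of_nonneg (by positivity)]
  have h1 : (1 + |x|) ^ (m - 2) ≤ (1 + |y|) ^ (m - 2) :=
    Real.rpow_le_rpow hx.le (by linarith) (by linarith)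
  have h2 := abs_exp_sub_exp_le (min_le_right u A) (min_le_right v A)
  have h3 : |min u A - min v A| ≤ |u - v| := by
    have := abs_min_sub_min_le_max u A v A
    simpa using this
  calc m * (1 + |x|) ^ (m - 2) * |Real.exp (min u A) - Real.exp (min v A)|
      ≤ m * (1 + |y|) ^ (m - 2) * (Real.exp A * |u - v|) := by gcongr; exact h2.trans (by gcongr)
    _ = _ := by ring

lemma continuous_cutoffNonlin_ray (m A : ℝ) {φ : ℝ → ℝ} (hφ : Continuous φ) (s : ℝ) :
    Continuous fun θ => cutoffNonlin m A (s * θ) (φ (s * θ)) := by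
  have h : Continuous fun θ : ℝ => s * θ := continuous_const.mul continuous_id
  exact (continuous_cutoffNonlin m A).comp (h.prodMk (hφ.comp h))

lemma abs_rayAvg_sub_le {m : ℝ} (hm : 2 < m) (A : ℝ) {φ ψ : ℝ → ℝ} (hφ : Continuous φ)
    (hψ : Continuous ψ) {δ : ℝ} (hδ : 0 ≤ δ) (h : ∀ x, |φ x - ψ x| ≤ δ * growthWeight m A x)
    (s : ℝ) : |rayAvg m A φ s - rayAvg m A ψ s|
      ≤ δ * (m * Real.exp A * (1 + |s|) ^ (m - 2) * growthWeight m A s) := by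
  have hs := one_add_abs_pos s
  have := intervalIntegral.norm_integral_le_of_norm_le_const (a := 0) (b := 1)
    (f := fun θ => cutoffNonlin m A (s * θ) (φ (s * θ)) - cutoffNonlin m A (s * θ) (ψ (s * θ)))
    (C := δ * (m * Real.exp A * (1 + |s|) ^ (m - 2) * growthWeight m A s))
    (fun θ hθ => by
      have h1 := abs_mul_le_of_mem_uIoc (s := s) hθ
      refine (abs_cutoffNonlin_sub_le hm A h1 _ _).trans ?_
      have h2 := (h (s * θ)).trans (mul_le_mul_of_nonneg_left (growthWeight_mono hm A h1) hδ)
      calc _ ≤ m * Real.exp A * (1 + |s|) ^ (m - 2) * (δ * growthWeight m A s) := by gcongr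
        _ = _ := by ring)
  rw [intervalIntegral.integral_sub
    ((continuous_cutoffNonlin_ray m A hφ s).intervalIntegrable _ _)
    ((continuous_cutoffNonlin_ray m A hψ s).intervalIntegrable _ _)] at this
  simpa [rayAvg] using this

lemma abs_integral_le_growthWeight {m : ℝ} (hm : 2 < m) (A : ℝ) {D : ℝ → ℝ} {δ : ℝ} (hδ : 0 ≤ δ)
    (h : ∀ s, |D s| ≤ δ * (m * Real.exp A * (1 + |s|) ^ (m - 2) * growthWeight m A s))
    {x : ℝ} (hx : 0 ≤ x) : |∫ s in (0 : ℝ)..x, D s| ≤ δ / 2 * growthWeight m A x := by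
  have hcont : Continuous fun s =>
      δ * (m * Real.exp A * (1 + |s|) ^ (m - 2) * growthWeight m A s) :=
    continuous_const.mul ((continuous_const.mul (continuous_one_add_abs_rpow _)).mul
      (continuous_growthWeight m A))
  have h1 := intervalIntegral.norm_integral_le_of_norm_le (μ := volume) hx
    (Eventually.of_forall fun s _ => (Real.norm_eq_abs _).trans_le (h s)) (hcont.intervalIntegrable 0 x)
  refine h1.trans ?_
  set c := 2 * (m * Real.exp A) / (m - 1) with hc
  have hder : ∀ s ∈ uIcc 0 x, HasDerivAt
      (fun s : ℝ => δ / 2 * Real.exp (c * (1 + s) ^ (m - 1)))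
      (δ * (m * Real.exp A * (1 + |s|) ^ (m - 2) * growthWeight m A s)) s := by
    intro s hs
    rw [uIcc_of_le hx] at hs
    have hs0 := hs.1
    have h2 : HasDerivAt (fun s : ℝ => (1 + s) ^ (m - 1)) (1 * (m - 1) * (1 + s) ^ (m - 1 - 1)) s :=
      ((hasDerivAt_id s).const_add 1).rpow_const (Or.inl (by simp; positivity))
    have h3 := ((h2.const_mul c).exp).const_mul (δ / 2)
    refine h3.congr_deriv ?_
    unfold growthWeight
    rw [abs_of_nonneg hs0, show m - 1 - 1 = m - 2 by ring, ← hc]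
    have : c * (m - 1) = 2 * (m * Real.exp A) := by
      rw [hc]; field_simp [show m - 1 ≠ 0 by linarith]
    linear_combination (δ / 2 * Real.exp (c * (1 + s) ^ (m - 1)) * (1 + s) ^ (m - 2)) * this
  rw [intervalIntegral.integral_eq_sub_of_hasDerivAt hder (hcont.intervalIntegrable 0 x)]
  unfold growthWeight
  rw [abs_of_nonneg hx, ← hc]
  have : 0 ≤ δ / 2 * Real.exp (c * (1 + 0) ^ (m - 1)) := by positivity
  linarith

/-- `U` solves `(x U')' = -m (1+x)^{m-2} e^U` on `(0,∞)` with derivative `V`, is regular at `0`,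
and takes the value `a` there. -/
structure IsProfile (m a : ℝ) (U V : ℝ → ℝ) : Prop where
  continuous_U : Continuous U
  continuous_V : Continuous V
  U_zero : U 0 = a
  V_zero : V 0 = -(m * Real.exp a)
  hasDerivAt_U : ∀ x, 0 < x → HasDerivAt U (V x) x
  hasDerivAt_V : ∀ x, 0 < x →
    HasDerivAt V (-(m * (1 + x) ^ (m - 2) * Real.exp (U x) + V x) / x) x

/-- The integral operator whose fixed points, multiplied by the weight, are the profiles. -/
def profileFun (m A a : ℝ) (φ : ℝ → ℝ) (x : ℝ) : ℝ :=
  a - ∫ s in (0 : ℝ)..|x|, rayAvg m A φ s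

lemma continuous_profileFun (m A a : ℝ) {φ : ℝ → ℝ} (hφ : Continuous φ) :
    Continuous (profileFun m A a φ) := by
  unfold profileFun
  refine continuous_const.sub ?_
  exact (intervalIntegral.continuous_primitive
    (fun a b => (continuous_rayAvg m A hφ).intervalIntegrable a b) 0).comp continuous_abs

lemma growthWeight_abs (m A x : ℝ) : growthWeight m A |x| = growthWeight m A x := by
  simp [growthWeight]

lemma abs_profileFun_div_le {m : ℝ} (hm : 2 < m) (A a : ℝ) (φ : ℝ → ℝ) (x : ℝ) :
    |profileFun m A a φ x / growthWeight m A x| ≤ |a| + 1 / 2 := by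
  have hw := growthWeight_pos m A x
  have hw1 := one_le_growthWeight hm A x
  rw [abs_div, abs_of_pos hw, div_le_iff₀ hw]
  have h1 := abs_integral_le_growthWeight hm A (D := rayAvg m A φ) zero_le_one (fun s => by
    have := abs_rayAvg_le hm A φ s
    have hs := one_add_abs_pos s
    refine this.trans ?_
    rw [one_mul]
    exact le_mul_of_one_le_right (by positivity) (one_le_growthWeight hm A s)) (abs_nonneg x)
  rw [growthWeight_abs] at h1
  have h2 := abs_sub a (∫ s in (0 : ℝ)..|x|, rayAvg m A φ s)
  unfold profileFun
  nlinarith [abs_nonneg a]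

/-- `profileFun` conjugated by the weight, acting on bounded continuous functions. -/
def profileOp {m : ℝ} (hm : 2 < m) (A a : ℝ) (b : BoundedContinuousFunction ℝ ℝ) :
    BoundedContinuousFunction ℝ ℝ :=
  BoundedContinuousFunction.ofNormedAddCommGroup
    (fun x => profileFun m A a (fun y => growthWeight m A y * b y) x / growthWeight m A x)
    ((continuous_profileFun m A a ((continuous_growthWeight m A).mul b.continuous)).div
      (continuous_growthWeight m A) fun x => (growthWeight_pos m A x).ne')
    (|a| + 1 / 2) (fun x => abs_profileFun_div_le hm A a _ x)

lemma profileOp_apply {m : ℝ} (hm : 2 < m) (A a : ℝ) (b : BoundedContinuousFunction ℝ ℝ) (x : ℝ) :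
    profileOp hm A a b x
      = profileFun m A a (fun y => growthWeight m A y * b y) x / growthWeight m A x := rfl

lemma abs_weight_mul_sub_le (m A : ℝ) (b c : BoundedContinuousFunction ℝ ℝ) (x : ℝ) :
    |growthWeight m A x * b x - growthWeight m A x * c x| ≤ dist b c * growthWeight m A x := by
  have hw := growthWeight_pos m A x
  rw [← mul_sub, abs_mul, abs_of_pos hw, mul_comm]
  have := BoundedContinuousFunction.dist_coe_le_dist (f := b) (g := c) x
  rw [Real.dist_eq] at this
  gcongr

lemma continuous_weight_mul (m A : ℝ) (b : BoundedContinuousFunction ℝ ℝ) :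
    Continuous fun x => growthWeight m A x * b x :=
  (continuous_growthWeight m A).mul b.continuous

lemma contracting_profileOp {m : ℝ} (hm : 2 < m) (A a : ℝ) :
    ContractingWith (1 / 2) (profileOp hm A a) := by
  refine ⟨by norm_num [← NNReal.coe_lt_coe], LipschitzWith.of_dist_le_mul fun b c => ?_⟩
  have hd : 0 ≤ dist b c := dist_nonneg
  rw [BoundedContinuousFunction.dist_le (by positivity)]
  intro x
  have hw := growthWeight_pos m A x
  rw [Real.dist_eq, profileOp_apply, profileOp_apply, ← sub_div, abs_div, abs_of_pos hw,
    div_le_iff₀ hw]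
  have hb := continuous_weight_mul m A b
  have hc := continuous_weight_mul m A c
  have h1 := abs_integral_le_growthWeight hm A hd
    (abs_rayAvg_sub_le hm A hb hc hd (abs_weight_mul_sub_le m A b c)) (abs_nonneg x)
  rw [intervalIntegral.integral_sub ((continuous_rayAvg m A hb).intervalIntegrable _ _)
    ((continuous_rayAvg m A hc).intervalIntegrable _ _), growthWeight_abs] at h1
  unfold profileFun
  rw [sub_sub_sub_cancel_left, abs_sub_comm]
  refine h1.trans (le_of_eq ?_)
  push_cast
  ring

lemma dist_profileOp_le {m : ℝ} (hm : 2 < m) (A a a' : ℝ) (b : BoundedContinuousFunction ℝ ℝ) :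
    dist (profileOp hm A a b) (profileOp hm A a' b) ≤ |a - a'| := by
  rw [BoundedContinuousFunction.dist_le (abs_nonneg _)]
  intro x
  have hw := growthWeight_pos m A x
  rw [Real.dist_eq, profileOp_apply, profileOp_apply, ← sub_div, abs_div, abs_of_pos hw,
    div_le_iff₀ hw]
  unfold profileFun
  rw [sub_sub_sub_cancel_right]
  exact le_mul_of_one_le_right (abs_nonneg _) (one_le_growthWeight hm A x)

lemma mul_rayAvg (m A : ℝ) (φ : ℝ → ℝ) (x : ℝ) :
    x * rayAvg m A φ x = ∫ s in (0 : ℝ)..x, cutoffNonlin m A s (φ s) := by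
  unfold rayAvg
  rw [intervalIntegral.mul_integral_comp_mul_left (f := fun s => cutoffNonlin m A s (φ s))]
  simp

lemma rayAvg_nonneg {m : ℝ} (hm : 2 < m) (A : ℝ) (φ : ℝ → ℝ) (x : ℝ) : 0 ≤ rayAvg m A φ x := by
  unfold rayAvg
  apply intervalIntegral.integral_nonneg zero_le_one
  intro θ _
  unfold cutoffNonlin
  have := one_add_abs_pos (x * θ)
  positivity

lemma isProfile_of_fixed {m : ℝ} (hm : 2 < m) {A a : ℝ} (ha : a ≤ A) {φ : ℝ → ℝ}
    (hφ : Continuous φ) (hfix : ∀ x, φ x = profileFun m A a φ x) :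
    IsProfile m a φ (fun x => -rayAvg m A φ x) := by
  have hcont := continuous_rayAvg m A hφ
  have hle : ∀ x, φ x ≤ A := by
    intro x
    rw [hfix x]
    unfold profileFun
    have : 0 ≤ ∫ s in (0 : ℝ)..|x|, rayAvg m A φ s :=
      intervalIntegral.integral_nonneg (abs_nonneg x) fun s _ => rayAvg_nonneg hm A φ s
    linarith
  have h0 : φ 0 = a := by rw [hfix 0]; simp [profileFun]
  have hderU : ∀ x, 0 < x → HasDerivAt φ (-rayAvg m A φ x) x := by
    intro x hx
    have h1 := (hcont.integral_hasStrictDerivAt 0 x).hasDerivAt.const_sub a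
    refine h1.congr_of_eventuallyEq ?_
    filter_upwards [lt_mem_nhds hx] with y hy
    rw [hfix y, profileFun, abs_of_pos hy]
  refine ⟨hφ, hcont.neg, h0, ?_, hderU, ?_⟩
  · simp only [rayAvg, zero_mul, cutoffNonlin, h0, min_eq_left ha]
    simp
  · intro x hx
    have hg : Continuous fun s => cutoffNonlin m A s (φ s) :=
      (continuous_cutoffNonlin m A).comp (continuous_id.prodMk hφ)
    have h1 := (hg.integral_hasStrictDerivAt 0 x).hasDerivAt
    have h2 := ((h1.div (hasDerivAt_id x) hx.ne').neg)
    have h3 : (fun x => -rayAvg m A φ x) =ᶠ[nhds x]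
        -((fun u => ∫ s in (0 : ℝ)..u, cutoffNonlin m A s (φ s)) / id) := by
      filter_upwards [lt_mem_nhds hx] with y hy
      simp only [Pi.neg_apply, Pi.div_apply, id]
      rw [← mul_rayAvg]
      field_simp
    refine (h2.congr_of_eventuallyEq h3).congr_deriv ?_
    simp only [id]
    rw [← mul_rayAvg]
    simp only [cutoffNonlin, min_eq_left (hle x), abs_of_pos hx]
    field_simp
    ring

lemma fixed_zero {m : ℝ} (hm : 2 < m) {A : ℝ} (hA : 0 ≤ A) (x : ℝ) :
    -(m * Real.log (1 + |x|)) = profileFun m A 0 (fun y => -(m * Real.log (1 + |y|))) x := by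
  have key : ∀ s : ℝ, 0 ≤ s →
      rayAvg m A (fun y => -(m * Real.log (1 + |y|))) s = m / (1 + s) := by
    intro s hs
    have h_integrand : ∀ y : ℝ, 0 ≤ y → cutoffNonlin m A y (-(m * Real.log (1 + |y|))) = m / (1 + y) ^ 2 := by
      intro y hy
      have hlog : 0 ≤ Real.log (1 + |y|) := Real.log_nonneg (by linarith [abs_nonneg y])
      have hy1 := one_add_abs_pos y
      have : -(m * Real.log (1 + |y|)) ≤ A := by nlinarith
      rw [cutoffNonlin, min_eq_left this, abs_of_nonneg hy] 
      rw [abs_of_nonneg hy] at hy1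
      rw [show -(m * Real.log (1 + y)) = Real.log (1 + y) * (-m) by ring,
        ← Real.rpow_def_of_pos hy1, mul_assoc, ← Real.rpow_add hy1,
        show m - 2 + -m = -(2 : ℕ) by push_cast; ring, Real.rpow_neg hy1.le, Real.rpow_natCast,
        div_eq_mul_inv]
    unfold rayAvg
    have hder : ∀ θ ∈ uIcc (0 : ℝ) 1, HasDerivAt (fun θ : ℝ => m * θ / (1 + s * θ))
        (cutoffNonlin m A (s * θ) (-(m * Real.log (1 + |s * θ|)))) θ := by
      intro θ hθ
      rw [uIcc_of_le zero_le_one] at hθ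
      have hsθ : 0 ≤ s * θ := mul_nonneg hs hθ.1
      have hne : 1 + s * θ ≠ 0 := by positivity
      rw [h_integrand _ hsθ]
      have h1 : HasDerivAt (fun θ : ℝ => m * θ) (m * 1) θ := (hasDerivAt_id θ).const_mul m
      have h2 : HasDerivAt (fun θ : ℝ => 1 + s * θ) (s * 1) θ :=
        ((hasDerivAt_id θ).const_mul s).const_add 1
      refine (h1.div h2 hne).congr_deriv ?_
      field_simp
      ring
    have hφ : Continuous fun y : ℝ => -(m * Real.log (1 + |y|)) :=
      (continuous_const.mul ((continuous_const.add continuous_abs).log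
        fun y => (one_add_abs_pos y).ne')).neg
    rw [intervalIntegral.integral_eq_sub_of_hasDerivAt hder
      ((continuous_cutoffNonlin_ray m A hφ s).intervalIntegrable _ _)]
    simp
  unfold profileFun
  have hder : ∀ s ∈ uIcc (0 : ℝ) |x|, HasDerivAt (fun s : ℝ => m * Real.log (1 + s))
      (m / (1 + s)) s := by
    intro s hs
    rw [uIcc_of_le (abs_nonneg x)] at hs
    have hs0 := hs.1
    have h1 : HasDerivAt (fun s : ℝ => 1 + s) 1 s := (hasDerivAt_id s).const_add 1
    refine ((h1.log (by positivity)).const_mul m).congr_deriv ?_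
    ring
  have hcongr : ∀ s ∈ uIcc (0 : ℝ) |x|,
      rayAvg m A (fun y => -(m * Real.log (1 + |y|))) s = m / (1 + s) := by
    intro s hs
    rw [uIcc_of_le (abs_nonneg x)] at hs
    exact key s hs.1
  rw [intervalIntegral.integral_congr hcongr, intervalIntegral.integral_eq_sub_of_hasDerivAt hder]
  · simp
  · apply ContinuousOn.intervalIntegrable
    refine continuousOn_const.div (by fun_prop) ?_
    intro s hs
    rw [uIcc_of_le (abs_nonneg x)] at hs
    have := hs.1
    positivity

theorem exists_profile_family {m : ℝ} (hm : 2 < m) {A : ℝ} (hA : 0 ≤ A) :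
    ∃ (U V : ℝ → ℝ → ℝ) (K : ℝ → ℝ), (∀ a ≤ A, IsProfile m a (U a) (V a)) ∧
      (∀ x y, 0 ≤ x → x ≤ y → K x ≤ K y) ∧
      (∀ a a' x, |U a x - U a' x| ≤ |a - a'| * K x) ∧
      (∀ a a' x, |V a x - V a' x| ≤ |a - a'| * K x) ∧
      (∀ x, U 0 x = -(m * Real.log (1 + |x|))) := by
  set b : ℝ → BoundedContinuousFunction ℝ ℝ := fun a =>
    ContractingWith.fixedPoint _ (contracting_profileOp hm A a) with hb
  set U : ℝ → ℝ → ℝ := fun a x => growthWeight m A x * b a x with hU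
  have hfix : ∀ a, profileOp hm A a (b a) = b a := fun a =>
    ContractingWith.fixedPoint_isFixedPt (contracting_profileOp hm A a)
  have hUc : ∀ a, Continuous (U a) := fun a => continuous_weight_mul m A (b a)
  have hUfix : ∀ a x, U a x = profileFun m A a (U a) x := by
    intro a x
    have h1 : b a x = _ := (congrArg (fun f => f x) (hfix a)).symm
    have h2 := profileOp_apply hm A a (b a) x
    have hw := (growthWeight_pos m A x).ne'
    simp only [hU]
    conv_lhs => rw [h1]
    rw [h2]
    field_simp
  have hdist : ∀ a a', dist (b a) (b a') ≤ 2 * |a - a'| := by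
    intro a a'
    have := ContractingWith.dist_fixedPoint_fixedPoint_of_dist_le' (contracting_profileOp hm A a)
      (profileOp hm A a') (hfix a) (hfix a') (dist_profileOp_le hm A a a')
    refine this.trans (le_of_eq ?_)
    push_cast
    ring
  have hUle : ∀ a a' x, |U a x - U a' x| ≤ (2 * |a - a'|) * growthWeight m A x := by
    intro a a' x
    refine (abs_weight_mul_sub_le m A _ _ x).trans ?_
    have := growthWeight_pos m A x
    gcongr
    exact hdist a a'
  refine ⟨U, fun a x => -rayAvg m A (U a) x,
    fun x => 2 * (1 + m * Real.exp A * (1 + |x|) ^ (m - 2)) * growthWeight m A x,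
    fun a ha => isProfile_of_fixed hm ha (hUc a) (hUfix a), ?_, ?_, ?_, ?_⟩
  · intro x y hx hxy
    have hxy' : |x| ≤ |y| := by rwa [abs_of_nonneg hx, abs_of_nonneg (hx.trans hxy)]
    have h1 : (1 + |x|) ^ (m - 2) ≤ (1 + |y|) ^ (m - 2) :=
      Real.rpow_le_rpow (one_add_abs_pos x).le (by linarith) (by linarith)
    have h2 := growthWeight_mono hm A hxy'
    have := growthWeight_pos m A x
    have := one_add_abs_pos y
    simp only
    gcongr
  · intro a a' x
    refine (hUle a a' x).trans ?_
    have h1 := growthWeight_pos m A x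
    have h2 := one_add_abs_pos x
    have h3 : 0 ≤ |a - a'| * (m * Real.exp A * (1 + |x|) ^ (m - 2) * growthWeight m A x) := by
      positivity
    linarith
  · intro a a' x
    simp only
    rw [neg_sub_neg, abs_sub_comm]
    refine (abs_rayAvg_sub_le hm A (hUc a) (hUc a') (by positivity) (hUle a a') x).trans ?_
    have h1 := growthWeight_pos m A x
    have h3 : 0 ≤ |a - a'| * growthWeight m A x := by positivity
    linarith
  · have hlogc : Continuous fun y : ℝ => -(m * Real.log (1 + |y|)) :=
      (continuous_const.mul ((continuous_const.add continuous_abs).log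
        fun y => (one_add_abs_pos y).ne')).neg
    set b0 : BoundedContinuousFunction ℝ ℝ := BoundedContinuousFunction.ofNormedAddCommGroup
      (fun x => -(m * Real.log (1 + |x|)) / growthWeight m A x)
      (hlogc.div (continuous_growthWeight m A) fun x => (growthWeight_pos m A x).ne')
      (|(0 : ℝ)| + 1 / 2) (fun x => by
        rw [fixed_zero hm hA x]
        exact abs_profileFun_div_le hm A 0 _ x) with hb0
    have hb0w : (fun y => growthWeight m A y * b0 y) = fun y => -(m * Real.log (1 + |y|)) := by
      funext y
      have hw := (growthWeight_pos m A y).ne'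
      change growthWeight m A y * (-(m * Real.log (1 + |y|)) / growthWeight m A y) = _
      field_simp
    have hfix0 : profileOp hm A 0 b0 = b0 := by
      ext x
      rw [profileOp_apply, hb0w, ← fixed_zero hm hA x]
      rfl
    have heq : b0 = b 0 := ContractingWith.fixedPoint_unique (contracting_profileOp hm A 0) hfix0
    intro x
    simp only [hU]
    rw [← heq]
    exact congrFun hb0w x

/-- The weight `4 e^{2t} / (1 + e^{2t})² = 1 / cosh² t`. -/
def sechSq (t : ℝ) : ℝ := 4 * Real.exp (2 * t) / (1 + Real.exp (2 * t)) ^ 2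

/-- `Z'' + m sech²(t) (e^Z - 1) = 0` on `ℝ` with `Z' = Y`, `Z → a` and `Y → 0` at `-∞`. -/
structure IsRegularSol (m a : ℝ) (Z Y : ℝ → ℝ) : Prop where
  hasDerivAt_Z : ∀ t, HasDerivAt Z (Y t) t
  hasDerivAt_Y : ∀ t, HasDerivAt Y (-(sechSq t * (m * (Real.exp (Z t) - 1)))) t
  tendsto_Z : Tendsto Z atBot (nhds a)
  tendsto_Y : Tendsto Y atBot (nhds 0)

/-- A profile in logarithmic coordinates, relative to the explicit solution. -/
def logProfile (m : ℝ) (U : ℝ → ℝ) (t : ℝ) : ℝ :=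
  U (Real.exp (2 * t)) + m * Real.log (1 + Real.exp (2 * t))

/-- The derivative of `logProfile`, where `V` is the derivative of `U`. -/
def logSlope (m : ℝ) (V : ℝ → ℝ) (t : ℝ) : ℝ :=
  2 * (Real.exp (2 * t) * V (Real.exp (2 * t)) + m * (1 - 1 / (1 + Real.exp (2 * t))))

lemma hasDerivAt_exp_two_mul (t : ℝ) :
    HasDerivAt (fun t : ℝ => Real.exp (2 * t)) (2 * Real.exp (2 * t)) t := by
  have h : HasDerivAt (fun t : ℝ => 2 * t) (2 * 1) t := (hasDerivAt_id t).const_mul 2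
  refine h.exp.congr_deriv ?_
  ring

lemma tendsto_exp_two_mul_atBot : Tendsto (fun t : ℝ => Real.exp (2 * t)) atBot (nhds 0) :=
  Real.tendsto_exp_atBot.comp (tendsto_id.const_mul_atBot two_pos)

lemma tendsto_exp_two_mul_atTop : Tendsto (fun t : ℝ => Real.exp (2 * t)) atTop atTop :=
  Real.tendsto_exp_atTop.comp (tendsto_id.const_mul_atTop two_pos)

lemma IsProfile.isRegularSol {m a : ℝ} {U V : ℝ → ℝ} (h : IsProfile m a U V) :
    IsRegularSol m a (logProfile m U) (logSlope m V) := by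
  have hpos : ∀ t : ℝ, 0 < Real.exp (2 * t) := fun t => Real.exp_pos _
  have h1pos : ∀ t : ℝ, 0 < 1 + Real.exp (2 * t) := fun t => by positivity
  refine ⟨fun t => ?_, fun t => ?_, ?_, ?_⟩
  · have hx := hasDerivAt_exp_two_mul t
    have hU := (h.hasDerivAt_U _ (hpos t)).comp t hx
    have hl := ((hx.const_add 1).log (h1pos t).ne').const_mul m
    refine (hU.add hl).congr_deriv ?_
    have := (h1pos t).ne'
    unfold logSlope
    field_simp
    ring
  · have hx := hasDerivAt_exp_two_mul t
    have hV := (h.hasDerivAt_V _ (hpos t)).comp t hx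
    have hi := (((hasDerivAt_const t (1 : ℝ)).div (hx.const_add 1) (h1pos t).ne').const_sub 1).const_mul m
    refine (((hx.mul hV).add hi).const_mul 2).congr_deriv ?_
    have h1 := (h1pos t).ne'
    have h2 := (hpos t).ne'
    have hexp : Real.exp (logProfile m U t)
        = Real.exp (U (Real.exp (2 * t))) * (1 + Real.exp (2 * t)) ^ m := by
      rw [logProfile, Real.exp_add, Real.rpow_def_of_pos (h1pos t), mul_comm m]
    have hpow : (1 + Real.exp (2 * t)) ^ m
        = (1 + Real.exp (2 * t)) ^ (m - 2) * (1 + Real.exp (2 * t)) ^ 2 := by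
      rw [← Real.rpow_natCast _ 2, ← Real.rpow_add (h1pos t)]
      norm_num
    rw [hexp, hpow]
    unfold sechSq
    simp only [Function.comp]
    field_simp
    ring
  · have hU : Tendsto (fun t : ℝ => U (Real.exp (2 * t))) atBot (nhds (U 0)) :=
      (h.continuous_U.tendsto 0).comp tendsto_exp_two_mul_atBot
    have hl : Tendsto (fun t : ℝ => Real.log (1 + Real.exp (2 * t))) atBot
        (nhds (Real.log (1 + 0))) :=
      (tendsto_exp_two_mul_atBot.const_add 1).log (by norm_num)
    have := hU.add (hl.const_mul m)
    simp only [h.U_zero, add_zero, Real.log_one, mul_zero] at this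
    exact this
  · have hV : Tendsto (fun t : ℝ => V (Real.exp (2 * t))) atBot (nhds (V 0)) :=
      (h.continuous_V.tendsto 0).comp tendsto_exp_two_mul_atBot
    have hi : Tendsto (fun t : ℝ => 1 / (1 + Real.exp (2 * t))) atBot (nhds (1 / (1 + 0))) :=
      tendsto_const_nhds.div (tendsto_exp_two_mul_atBot.const_add 1) (by norm_num)
    have := ((tendsto_exp_two_mul_atBot.mul hV).add ((hi.const_sub 1).const_mul m)).const_mul 2
    simp only [zero_mul, add_zero, div_one, sub_self, mul_zero] at this
    exact this

/-- The function on the half line attached to a profile. -/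
def profileSol (m : ℝ) (U : ℝ → ℝ) (r : ℝ) : ℝ := (U (r ^ 2) + Real.log (2 * m)) / 2

lemma IsProfile.hasDerivAt_profileSol {m a : ℝ} {U V : ℝ → ℝ} (h : IsProfile m a U V) (r : ℝ) :
    HasDerivAt (profileSol m U) (r * V (r ^ 2)) r := by
  have hne : ∀ r : ℝ, r ≠ 0 → HasDerivAt (profileSol m U) (r * V (r ^ 2)) r := by
    intro r hr
    have h1 : HasDerivAt (fun r : ℝ => r ^ 2) (2 * r) r := by simpa using hasDerivAt_pow 2 r
    have h2 := HasDerivAt.comp r (h.hasDerivAt_U (r ^ 2) (by positivity)) h1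
    refine ((h2.add_const (Real.log (2 * m))).div_const 2).congr_deriv ?_
    ring
  rcases eq_or_ne r 0 with rfl | hr
  · have hUc := h.continuous_U
    have hVc := h.continuous_V
    refine hasDerivAt_of_hasDerivAt_of_ne (g := fun r => r * V (r ^ 2)) hne ?_ ?_
    · have : Continuous (profileSol m U) := by unfold profileSol; fun_prop
      exact this.continuousAt
    · have : Continuous fun r => r * V (r ^ 2) := by fun_prop
      exact this.continuousAt
  · exact hne r hr

lemma IsProfile.hasDerivAt_profileSol_deriv {m a : ℝ} {U V : ℝ → ℝ} (h : IsProfile m a U V)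
    (r : ℝ) : HasDerivAt (fun r => r * V (r ^ 2))
      (-V (r ^ 2) - 2 * (m * (1 + r ^ 2) ^ (m - 2) * Real.exp (U (r ^ 2)))) r := by
  have hUc := h.continuous_U
  have hVc := h.continuous_V
  have hne : ∀ r : ℝ, r ≠ 0 → HasDerivAt (fun r => r * V (r ^ 2))
      (-V (r ^ 2) - 2 * (m * (1 + r ^ 2) ^ (m - 2) * Real.exp (U (r ^ 2)))) r := by
    intro r hr
    have h1 : HasDerivAt (fun r : ℝ => r ^ 2) (2 * r) r := by simpa using hasDerivAt_pow 2 r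
    have h2 := HasDerivAt.comp r (h.hasDerivAt_V (r ^ 2) (by positivity)) h1
    refine ((hasDerivAt_id r).mul h2).congr_deriv ?_
    simp only [Function.comp, id]
    field_simp
    ring
  rcases eq_or_ne r 0 with rfl | hr
  · refine hasDerivAt_of_hasDerivAt_of_ne (g := fun r =>
      -V (r ^ 2) - 2 * (m * (1 + r ^ 2) ^ (m - 2) * Real.exp (U (r ^ 2)))) hne ?_ ?_
    · have : Continuous fun r => r * V (r ^ 2) := by fun_prop
      exact this.continuousAt
    · have hp : Continuous fun r : ℝ => (1 + r ^ 2) ^ (m - 2) :=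
        Continuous.rpow_const (by fun_prop) fun r => Or.inl (by positivity)
      have : Continuous fun r =>
        -V (r ^ 2) - 2 * (m * (1 + r ^ 2) ^ (m - 2) * Real.exp (U (r ^ 2))) := by fun_prop
      exact this.continuousAt
  · exact hne r hr

lemma IsProfile.isSolLevelN2 {N a : ℝ} (hN : 0 < N) {U V : ℝ → ℝ} (h : IsProfile (N + 2) a U V)
    (hlim : Tendsto (logSlope (N + 2) V) atTop (nhds 0)) :
    IsSolLevelN2 N (profileSol (N + 2) U) := by
  have hUc := h.continuous_U
  have hVc := h.continuous_V
  have hNN : N + 2 - 2 = N := by ring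
  have hd1 := h.hasDerivAt_profileSol
  have hd2 := h.hasDerivAt_profileSol_deriv
  rw [hNN] at hd2
  have hderiv : deriv (profileSol (N + 2) U) = fun r => r * V (r ^ 2) := funext fun r => (hd1 r).deriv
  have hderiv2 : deriv (fun r => r * V (r ^ 2)) = fun r =>
      -V (r ^ 2) - 2 * ((N + 2) * (1 + r ^ 2) ^ N * Real.exp (U (r ^ 2))) :=
    funext fun r => (hd2 r).deriv
  have hp : Continuous fun r : ℝ => (1 + r ^ 2) ^ N :=
    Continuous.rpow_const (by fun_prop) fun r => Or.inl (by positivity)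
  have hexp : ∀ r, Real.exp (2 * profileSol (N + 2) U r) = 2 * (N + 2) * Real.exp (U (r ^ 2)) := by
    intro r
    rw [profileSol, mul_div_cancel₀ _ (two_ne_zero), Real.exp_add, Real.exp_log (by positivity)]
    ring
  have hC2 : ContDiff ℝ 2 (profileSol (N + 2) U) := by
    rw [show (2 : WithTop ℕ∞) = 1 + 1 by norm_num, contDiff_succ_iff_deriv]
    refine ⟨fun r => (hd1 r).differentiableAt, by simp, ?_⟩
    rw [hderiv, contDiff_one_iff_deriv]
    refine ⟨fun r => (hd2 r).differentiableAt, ?_⟩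
    rw [hderiv2]
    fun_prop
  have hM : ∀ r, HasDerivAt (fun r => -(r * (r * V (r ^ 2))))
      ((1 + r ^ 2) ^ N * Real.exp (2 * profileSol (N + 2) U r) * r) r := by
    intro r
    refine ((hasDerivAt_id r).mul (hd2 r)).neg.congr_deriv ?_
    rw [hexp]
    simp only [id]
    ring
  have hMnn : ∀ r ∈ Ioi (0 : ℝ),
      0 ≤ (1 + r ^ 2) ^ N * Real.exp (2 * profileSol (N + 2) U r) * r := by
    intro r hr
    have : 0 < r := hr
    positivity
  have hMlim : Tendsto (fun r => -(r * (r * V (r ^ 2)))) atTop (nhds (N + 2)) := by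
    have h1 : Tendsto (fun r : ℝ => logSlope (N + 2) V (Real.log r)) atTop (nhds 0) :=
      hlim.comp Real.tendsto_log_atTop
    have h2 : Tendsto (fun r : ℝ => 1 / (1 + r ^ 2)) atTop (nhds 0) := by
      simp only [one_div]
      exact tendsto_inv_atTop_zero.comp
        (tendsto_atTop_add_const_left _ _ (tendsto_pow_atTop two_ne_zero))
    have h3 := ((h2.const_sub 1).const_mul (N + 2)).sub (h1.div_const 2)
    simp only [sub_zero, mul_one, zero_div] at h3
    refine h3.congr' ?_
    filter_upwards [eventually_gt_atTop 0] with r hr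
    have : Real.exp (2 * Real.log r) = r ^ 2 := by
      rw [two_mul, Real.exp_add, Real.exp_log hr, sq]
    rw [logSlope, this]
    ring
  refine ⟨hC2.contDiffOn, ?_, ?_, ?_, ?_⟩
  · rw [(hd1 0).hasDerivWithinAt.derivWithin (uniqueDiffOn_Ici 0 0 self_mem_Ici)]
    simp
  · intro r hr
    rw [hderiv, hderiv2, hexp]
    field_simp
    ring
  · exact integrableOn_Ioi_deriv_of_nonneg' (fun r _ => hM r) hMnn hMlim
  · rw [integral_Ioi_of_hasDerivAt_of_nonneg' (fun r _ => hM r) hMnn hMlim]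
    simp

lemma ustar_eq_profileSol {N : ℝ} (hN : 0 < N) {U : ℝ → ℝ}
    (hU : ∀ x, U x = -((N + 2) * Real.log (1 + |x|))) (r : ℝ) :
    profileSol (N + 2) U r = ustar N r := by
  have h1 : 0 < 1 + r ^ 2 := by positivity
  rw [profileSol, ustar, hU, abs_of_nonneg (sq_nonneg r),
    Real.log_div (by positivity) (Real.rpow_pos_of_pos h1 _).ne', Real.log_rpow h1]
  ring

lemma sechSq_pos (t : ℝ) : 0 < sechSq t := by unfold sechSq; positivity

lemma continuous_sechSq : Continuous sechSq := by
  unfold sechSq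
  exact Continuous.div (by fun_prop) (by fun_prop) fun t => by positivity

lemma sechSq_le_exp_neg (t : ℝ) : sechSq t ≤ 4 * Real.exp (-(2 * t)) := by
  have h := Real.exp_pos (2 * t)
  rw [sechSq, Real.exp_neg, div_le_iff₀ (by positivity)]
  have : 4 * (Real.exp (2 * t))⁻¹ * (1 + Real.exp (2 * t)) ^ 2
      = 4 * Real.exp (2 * t) + 8 + 4 * (Real.exp (2 * t))⁻¹ := by
    field_simp
    ring
  rw [this]
  have h2 := inv_pos.2 h
  linarith

lemma exp_neg_le_sechSq {t : ℝ} (ht : 0 ≤ t) : Real.exp (-(2 * t)) ≤ sechSq t := by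
  have h : 1 ≤ Real.exp (2 * t) := Real.one_le_exp (by linarith)
  rw [sechSq, Real.exp_neg, le_div_iff₀ (by positivity), inv_mul_le_iff₀ (by positivity)]
  nlinarith

lemma le_of_hasDerivAt_nonneg {f f' : ℝ → ℝ} {a b : ℝ} (hab : a ≤ b)
    (hf : ∀ t, HasDerivAt f (f' t) t) (h : ∀ t ∈ Ioo a b, 0 ≤ f' t) : f a ≤ f b := by
  refine monotoneOn_of_deriv_nonneg (convex_Icc a b)
    (fun t _ => (hf t).continuousAt.continuousWithinAt)
    (fun t _ => (hf t).differentiableAt.differentiableWithinAt) (fun t ht => ?_)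
    (left_mem_Icc.2 hab) (right_mem_Icc.2 hab) hab
  rw [interior_Icc] at ht
  rw [(hf t).deriv]
  exact h t ht

lemma lt_of_hasDerivAt_pos {f f' : ℝ → ℝ} {a b : ℝ} (hab : a < b)
    (hf : ∀ t, HasDerivAt f (f' t) t) (h : ∀ t ∈ Ioo a b, 0 < f' t) : f a < f b := by
  refine strictMonoOn_of_deriv_pos (convex_Icc a b)
    (fun t _ => (hf t).continuousAt.continuousWithinAt) (fun t ht => ?_)
    (left_mem_Icc.2 hab.le) (right_mem_Icc.2 hab.le) hab
  rw [interior_Icc] at ht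
  rw [(hf t).deriv]
  exact h t ht

lemma exists_gt_pos_of_hasDerivAt_pos {f : ℝ → ℝ} {f' c : ℝ} (hf : HasDerivAt f f' c) (h0 : 0 ≤ f c)
    (h : 0 < f') : ∃ d > c, ∀ t ∈ Ioo c d, 0 < f t := by
  have h1 := (hasDerivWithinAt_iff_tendsto_slope' (s := Ioi c) (lt_irrefl c)).1 hf.hasDerivWithinAt
  obtain ⟨d, hd, hd'⟩ := mem_nhdsGT_iff_exists_Ioo_subset.1 (h1.eventually (lt_mem_nhds h))
  refine ⟨d, hd, fun t ht => ?_⟩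
  have h2 : 0 < slope f c t := hd' ht
  rw [slope_def_field] at h2
  have h3 : 0 < t - c := sub_pos.2 ht.1
  have := (div_pos_iff_of_pos_right h3).1 h2
  linarith

lemma exists_lt_neg_of_hasDerivAt_pos {f : ℝ → ℝ} {f' c : ℝ} (hf : HasDerivAt f f' c) (h0 : f c ≤ 0)
    (h : 0 < f') : ∃ d < c, ∀ t ∈ Ioo d c, f t < 0 := by
  have h1 := (hasDerivWithinAt_iff_tendsto_slope' (s := Iio c) (lt_irrefl c)).1 hf.hasDerivWithinAt
  obtain ⟨d, hd, hd'⟩ := mem_nhdsLT_iff_exists_Ioo_subset.1 (h1.eventually (lt_mem_nhds h))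
  refine ⟨d, hd, fun t ht => ?_⟩
  have h2 : 0 < slope f c t := hd' ht
  rw [slope_def_field] at h2
  have h3 : t - c < 0 := sub_neg.2 ht.2
  by_contra! hcon
  exact absurd h2 (not_lt.2 (div_nonpos_of_nonneg_of_nonpos (by linarith) h3.le))

lemma deriv_nonpos_of_pos_left {f : ℝ → ℝ} {f' s c : ℝ} (hf : HasDerivAt f f' c) (h0 : f c = 0)
    (hs : s < c) (h : ∀ t ∈ Ioo s c, 0 < f t) : f' ≤ 0 := by
  by_contra! hcon
  obtain ⟨d, hd, hd'⟩ := exists_lt_neg_of_hasDerivAt_pos hf h0.le hcon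
  have h1 : max s d < c := max_lt hs hd
  obtain ⟨t, ht⟩ := exists_between h1
  have := h t ⟨(le_max_left _ _).trans_lt ht.1, ht.2⟩
  have := hd' t ⟨(le_max_right _ _).trans_lt ht.1, ht.2⟩
  linarith

lemma deriv_nonneg_of_pos_right {f : ℝ → ℝ} {f' s c : ℝ} (hf : HasDerivAt f f' c) (h0 : f c = 0)
    (hs : c < s) (h : ∀ t ∈ Ioo c s, 0 < f t) : 0 ≤ f' := by
  by_contra! hcon
  obtain ⟨d, hd, hd'⟩ := exists_gt_pos_of_hasDerivAt_pos hf.neg (by simp [h0]) (neg_pos.2 hcon)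
  obtain ⟨t, ht⟩ := exists_between (lt_min hs hd)
  have := h t ⟨ht.1, ht.2.trans_le (min_le_left _ _)⟩
  have := hd' t ⟨ht.1, ht.2.trans_le (min_le_right _ _)⟩
  simp only [Pi.neg_apply] at this
  linarith

/-- The first zero of a continuous function to the right of a point where it is positive. -/
lemma exists_first_zero {f : ℝ → ℝ} (hf : Continuous f) {s b : ℝ} (hsb : s ≤ b) (hs : 0 < f s)
    (hb : f b ≤ 0) : ∃ c, s < c ∧ c ≤ b ∧ f c = 0 ∧ ∀ t, s ≤ t → t < c → 0 < f t := by
  have hne : (Icc s b ∩ f ⁻¹' {0}).Nonempty := by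
    obtain ⟨c, hc, hc0⟩ := intermediate_value_Icc' hsb hf.continuousOn ⟨hb, hs.le⟩
    exact ⟨c, hc, hc0⟩
  have hcomp : IsCompact (Icc s b ∩ f ⁻¹' {0}) :=
    isCompact_Icc.inter_right (isClosed_singleton.preimage hf)
  obtain ⟨c, ⟨⟨hc1, hc2⟩, hc0⟩, hmin⟩ := hcomp.exists_isLeast hne
  have hc0 : f c = 0 := hc0
  refine ⟨c, lt_of_le_of_ne hc1 fun h => ?_, hc2, hc0, fun t hst htc => ?_⟩
  · rw [← h] at hc0; linarith
  · by_contra! hcon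
    obtain ⟨d, hd, hd0⟩ := intermediate_value_Icc' hst hf.continuousOn ⟨hcon, hs.le⟩
    have := hmin ⟨⟨hd.1, hd.2.trans (htc.le.trans hc2)⟩, hd0⟩
    linarith [hd.2]

/-- The first zero after a point where the function is nonnegative and increasing. -/
lemma exists_first_zero_of_deriv_pos {f : ℝ → ℝ} (hf : Continuous f) {f' s b : ℝ} (hsb : s < b)
    (hs : 0 ≤ f s) (hd : HasDerivAt f f' s) (hpos : 0 < f')
    (hb : f b ≤ 0) : ∃ c, s < c ∧ c ≤ b ∧ f c = 0 ∧ ∀ t, s < t → t < c → 0 < f t := by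
  obtain ⟨d, hd, hd'⟩ := exists_gt_pos_of_hasDerivAt_pos hd hs hpos
  obtain ⟨e, he⟩ := exists_between (lt_min hsb hd)
  have he2 := he.2.trans_le (min_le_left _ _)
  have he3 := he.2.trans_le (min_le_right _ _)
  obtain ⟨c, h1, h2, h3, h4⟩ := exists_first_zero hf he2.le (hd' e ⟨he.1, he3⟩) hb
  refine ⟨c, he.1.trans h1, h2, h3, fun t ht htc => ?_⟩
  rcases le_total e t with h | h
  · exact h4 t h htc
  · exact hd' t ⟨ht, h.trans_lt he3⟩

namespace IsRegularSol

variable {m a : ℝ} {Z Y : ℝ → ℝ}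

lemma continuous_Z (h : IsRegularSol m a Z Y) : Continuous Z :=
  continuous_iff_continuousAt.2 fun t => (h.hasDerivAt_Z t).continuousAt

lemma continuous_Y (h : IsRegularSol m a Z Y) : Continuous Y :=
  continuous_iff_continuousAt.2 fun t => (h.hasDerivAt_Y t).continuousAt

lemma Y_le_of_nonneg (hm : 0 < m) (h : IsRegularSol m a Z Y) {s t : ℝ} (hst : s ≤ t)
    (hZ : ∀ r ∈ Ioo s t, 0 ≤ Z r) : Y t ≤ Y s := by
  have := le_of_hasDerivAt_nonneg hst (fun r => (h.hasDerivAt_Y r).neg) fun r hr => by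
    have h1 := sechSq_pos r
    have h2 := Real.one_le_exp (hZ r hr)
    rw [neg_neg]
    exact mul_nonneg h1.le (mul_nonneg hm.le (by linarith))
  simp only [Pi.neg_apply] at this
  linarith

lemma le_Y_of_nonpos (hm : 0 < m) (h : IsRegularSol m a Z Y) {s t : ℝ} (hst : s ≤ t)
    (hZ : ∀ r ∈ Ioo s t, Z r ≤ 0) : Y s ≤ Y t :=
  le_of_hasDerivAt_nonneg hst h.hasDerivAt_Y fun r hr => by
    have h1 := sechSq_pos r
    have h2 := Real.exp_le_one_iff.2 (hZ r hr)
    rw [← mul_neg, ← mul_neg]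
    exact mul_nonneg h1.le (mul_nonneg hm.le (by linarith))

end IsRegularSol

/-- The total change of slope after time `t` of a solution growing linearly with slope `s` from
height `z` at time `T`. -/
def slopeBarrier (m T z s t : ℝ) : ℝ :=
  4 * m * (Real.exp (z - 2 * T + (s - 2) * (t - T)) / (2 - s) - Real.exp (-(2 * t)) / 2)

lemma hasDerivAt_slopeBarrier (m T z : ℝ) {s : ℝ} (hs : s < 2) (t : ℝ) :
    HasDerivAt (slopeBarrier m T z s)
      (-(4 * Real.exp (-(2 * t)) * (m * (Real.exp (z + s * (t - T)) - 1)))) t := by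
  have h1 : HasDerivAt (fun t => z - 2 * T + (s - 2) * (t - T)) ((s - 2) * 1) t :=
    (((hasDerivAt_id t).sub_const T).const_mul (s - 2)).const_add _
  have h2 : HasDerivAt (fun t : ℝ => -(2 * t)) (-(2 * 1)) t := ((hasDerivAt_id t).const_mul 2).neg
  refine (((h1.exp.div_const (2 - s)).sub (h2.exp.div_const 2)).const_mul (4 * m)).congr_deriv ?_
  have h3 : Real.exp (z - 2 * T + (s - 2) * (t - T))
      = Real.exp (-(2 * t)) * Real.exp (z + s * (t - T)) := by
    rw [← Real.exp_add]; ring_nf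
  have h4 : 2 - s ≠ 0 := by linarith
  rw [h3]
  field_simp
  ring

lemma slopeBarrier_eq (m T z s t : ℝ) : slopeBarrier m T z s t =
    4 * m * Real.exp (-(2 * t)) * (Real.exp (z + s * (t - T)) / (2 - s) - 1 / 2) := by
  have h3 : Real.exp (z - 2 * T + (s - 2) * (t - T))
      = Real.exp (-(2 * t)) * Real.exp (z + s * (t - T)) := by
    rw [← Real.exp_add]; ring_nf
  rw [slopeBarrier, h3]
  ring

namespace IsRegularSol

variable {m a : ℝ} {Z Y : ℝ → ℝ}

theorem pos_of_slopeBarrier_lt (hm : 0 < m) (h : IsRegularSol m a Z Y) {T : ℝ} (hZ : 0 ≤ Z T)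
    (hY : 0 < Y T) (hY2 : Y T < 2) (hB : slopeBarrier m T (Z T) (Y T) T < Y T) {t : ℝ}
    (ht : T < t) : 0 < Z t := by
  by_contra! hcon
  obtain ⟨c, hTc, -, hc0, hpos⟩ :=
    exists_first_zero_of_deriv_pos h.continuous_Z ht hZ (h.hasDerivAt_Z T) hY hcon
  have hYle : ∀ r, T ≤ r → r ≤ c → Y r ≤ Y T := fun r h1 h2 =>
    h.Y_le_of_nonneg hm h1 fun s hs => (hpos s hs.1 (hs.2.trans_le h2)).le
  have hZle : ∀ r, T ≤ r → r ≤ c → Z r ≤ Z T + Y T * (r - T) := fun r h1 h2 => by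
    have := le_of_hasDerivAt_nonneg h1
      (fun s => ((hasDerivAt_id s).const_mul (Y T)).sub (h.hasDerivAt_Z s)) fun s hs => by
        have := hYle s hs.1.le (hs.2.le.trans h2)
        linarith
    simp only [Pi.sub_apply, id] at this
    linarith
  have key := le_of_hasDerivAt_nonneg hTc.le
    (fun s => (h.hasDerivAt_Y s).sub (hasDerivAt_slopeBarrier m T (Z T) hY2 s)) fun s hs => by
      have h1 := sechSq_le_exp_neg s
      have h2 := Real.exp_le_exp.2 (hZle s hs.1.le hs.2.le)
      have h3 := Real.one_le_exp (hpos s hs.1 hs.2).le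
      have h4 := mul_le_mul h1 (mul_le_mul_of_nonneg_left (sub_le_sub_right h2 1) hm.le)
        (mul_nonneg hm.le (by linarith)) (by positivity)
      linarith
  simp only [Pi.sub_apply] at key
  have hBc : 0 ≤ slopeBarrier m T (Z T) (Y T) c := by
    rw [slopeBarrier_eq]
    have h1 : 1 ≤ Real.exp (Z T + Y T * (c - T)) :=
      Real.one_le_exp (add_nonneg hZ (mul_nonneg hY.le (by linarith)))
    have h2 : 1 / 2 ≤ Real.exp (Z T + Y T * (c - T)) / (2 - Y T) := by
      rw [div_le_div_iff₀ (by norm_num) (by linarith)]; linarith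
    exact mul_nonneg (by positivity) (by linarith)
  have := deriv_nonpos_of_pos_left (h.hasDerivAt_Z c) hc0 hTc fun t ht => hpos t ht.1 ht.2
  linarith

theorem neg_of_lt_slopeBarrier (hm : 0 < m) (h : IsRegularSol m a Z Y) {T : ℝ} (hZ : Z T ≤ 0)
    (hY : Y T < 0) (hB : Y T < slopeBarrier m T (Z T) (Y T) T) {t : ℝ}
    (ht : T < t) : Z t < 0 := by
  by_contra! hcon
  obtain ⟨c, hTc, -, hc0, hpos⟩ :=
    exists_first_zero_of_deriv_pos (f := -Z) h.continuous_Z.neg ht (by simpa using hZ)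
      (h.hasDerivAt_Z T).neg (neg_pos.2 hY) (by simpa using hcon)
  simp only [Pi.neg_apply, neg_eq_zero, Left.neg_pos_iff] at hc0 hpos
  have hYle : ∀ r, T ≤ r → r ≤ c → Y T ≤ Y r := fun r h1 h2 =>
    h.le_Y_of_nonpos hm h1 fun s hs => (hpos s hs.1 (hs.2.trans_le h2)).le
  have hZle : ∀ r, T ≤ r → r ≤ c → Z T + Y T * (r - T) ≤ Z r := fun r h1 h2 => by
    have := le_of_hasDerivAt_nonneg h1
      (fun s => (h.hasDerivAt_Z s).sub ((hasDerivAt_id s).const_mul (Y T))) fun s hs => by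
        have := hYle s hs.1.le (hs.2.le.trans h2)
        linarith
    simp only [Pi.sub_apply, id] at this
    linarith
  have key := le_of_hasDerivAt_nonneg hTc.le
    (fun s => (hasDerivAt_slopeBarrier m T (Z T) (hY.trans two_pos) s).sub (h.hasDerivAt_Y s))
    fun s hs => by
      have h1 := sechSq_le_exp_neg s
      have h2 := Real.exp_le_exp.2 (hZle s hs.1.le hs.2.le)
      have h3 := Real.exp_le_one_iff.2 (hpos s hs.1 hs.2).le
      have h4 := mul_le_mul h1 (mul_le_mul_of_nonneg_left (sub_le_sub_left h2 1) hm.le)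
        (mul_nonneg hm.le (by linarith)) (by positivity)
      linarith
  simp only [Pi.sub_apply] at key
  have hBc : slopeBarrier m T (Z T) (Y T) c ≤ 0 := by
    rw [slopeBarrier_eq]
    have h1 : Real.exp (Z T + Y T * (c - T)) ≤ 1 :=
      Real.exp_le_one_iff.2 (add_nonpos hZ (mul_nonpos_of_nonpos_of_nonneg hY.le (by linarith)))
    have h2 : Real.exp (Z T + Y T * (c - T)) / (2 - Y T) ≤ 1 / 2 := by
      rw [div_le_div_iff₀ (by linarith) (by norm_num)]; linarith
    exact mul_nonpos_of_nonneg_of_nonpos (by positivity) (by linarith)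
  have := deriv_nonpos_of_pos_left (h.hasDerivAt_Z c).neg (by simp [hc0]) hTc fun t ht => by
    simpa using hpos t ht.1 ht.2
  linarith

/-- A solution descending through zero late stays negative. -/
lemma neg_after_zero (hm : 0 < m) (h : IsRegularSol m a Z Y) {T : ℝ} (hZ : Z T = 0)
    (hY : Y T < 0) (hT : m * Real.exp (-(2 * T)) ≤ 1) {t : ℝ} (ht : T < t) : Z t < 0 := by
  refine h.neg_of_lt_slopeBarrier hm hZ.le hY ?_ ht
  rw [slopeBarrier_eq, hZ]
  have h2 : 0 < 2 - Y T := by linarith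
  have h3 : 4 * m * Real.exp (-(2 * T)) * (Real.exp (0 + Y T * (T - T)) / (2 - Y T) - 1 / 2)
      = 2 * (m * Real.exp (-(2 * T))) * (Y T / (2 - Y T)) := by
    rw [sub_self, mul_zero, add_zero, Real.exp_zero]
    field_simp
    ring
  rw [h3, ← mul_div_assoc, lt_div_iff₀ h2]
  nlinarith

lemma neg_of_slope_lt (hm : 0 < m) (h : IsRegularSol m a Z Y) {T : ℝ} (hZ : Z T ≤ 0)
    (hY : Y T < -(2 * (m * Real.exp (-(2 * T))))) {t : ℝ} (ht : T < t) : Z t < 0 := by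
  have h0 : 0 < m * Real.exp (-(2 * T)) := by positivity
  have hY0 : Y T < 0 := by linarith
  refine h.neg_of_lt_slopeBarrier hm hZ hY0 ?_ ht
  rw [slopeBarrier_eq]
  have h1 : 0 < Real.exp (Z T + Y T * (T - T)) / (2 - Y T) :=
    div_pos (Real.exp_pos _) (by linarith)
  nlinarith

/-- A solution rising slowly through zero late stays positive. -/
lemma pos_after_zero (hm : 0 < m) (h : IsRegularSol m a Z Y) {T : ℝ} (hZ : Z T = 0)
    (hY : 0 < Y T) (hY1 : Y T ≤ 1) (hT : 2 * m * Real.exp (-(2 * T)) < 1) {t : ℝ} (ht : T < t) :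
    0 < Z t := by
  refine h.pos_of_slopeBarrier_lt hm hZ.ge hY (by linarith) ?_ ht
  rw [slopeBarrier_eq, hZ]
  have h2 : 0 < 2 - Y T := by linarith
  have h3 : 4 * m * Real.exp (-(2 * T)) * (Real.exp (0 + Y T * (T - T)) / (2 - Y T) - 1 / 2)
      = 2 * m * Real.exp (-(2 * T)) * (Y T / (2 - Y T)) := by
    rw [sub_self, mul_zero, add_zero, Real.exp_zero]
    field_simp
    ring
  rw [h3, ← mul_div_assoc, div_lt_iff₀ h2]
  nlinarith

end IsRegularSol

lemma le_of_hasDerivAt_nonpos_of_tendsto_atBot {f f' : ℝ → ℝ} {l : ℝ}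
    (hf : ∀ t, HasDerivAt f (f' t) t) (t : ℝ) (h : ∀ s < t, f' s ≤ 0)
    (hl : Tendsto f atBot (nhds l)) : f t ≤ l := by
  refine ge_of_tendsto hl ?_
  filter_upwards [eventually_le_atBot t] with s hs
  have := le_of_hasDerivAt_nonneg hs (fun r => (hf r).neg) fun r hr => by
    have := h r hr.2
    linarith
  simpa using this

lemma sechSq_le_one (t : ℝ) : sechSq t ≤ 1 := by
  unfold sechSq
  rw [div_le_one (by positivity)]
  nlinarith [sq_nonneg (Real.exp (2 * t) - 1)]

lemma tendsto_exp_neg_two_mul_atTop :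
    Tendsto (fun t : ℝ => Real.exp (-(2 * t))) atTop (nhds 0) :=
  Real.tendsto_exp_neg_atTop_nhds_zero.comp (tendsto_id.const_mul_atTop two_pos)

lemma hasDerivAt_exp_neg_two_mul (t : ℝ) :
    HasDerivAt (fun t : ℝ => Real.exp (-(2 * t))) (-(2 * Real.exp (-(2 * t)))) t := by
  have h2 : HasDerivAt (fun t : ℝ => -(2 * t)) (-(2 * 1)) t := ((hasDerivAt_id t).const_mul 2).neg
  refine h2.exp.congr_deriv ?_
  ring

namespace IsRegularSol

variable {m a : ℝ} {Z Y : ℝ → ℝ}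

lemma Y_le (hm : 0 < m) (h : IsRegularSol m a Z Y) (t : ℝ) :
    Y t ≤ 2 * m * (1 - 1 / (1 + Real.exp (2 * t))) := by
  have hd : ∀ t : ℝ, HasDerivAt (fun t : ℝ => 2 * m * (1 - 1 / (1 + Real.exp (2 * t))))
      (m * sechSq t) t := fun t => by
    have h1 : (1 + Real.exp (2 * t)) ≠ 0 := by positivity
    refine (((hasDerivAt_const t (1 : ℝ)).div ((hasDerivAt_exp_two_mul t).const_add 1)
      h1).const_sub 1 |>.const_mul (2 * m)).congr_deriv ?_
    rw [sechSq]
    field_simp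
    ring
  have hl : Tendsto (fun t : ℝ => 2 * m * (1 - 1 / (1 + Real.exp (2 * t)))) atBot (nhds 0) := by
    have := (((tendsto_const_nhds (x := (1 : ℝ))).div (tendsto_exp_two_mul_atBot.const_add 1)
      (by norm_num)).const_sub 1).const_mul (2 * m)
    simpa using this
  have := le_of_hasDerivAt_nonpos_of_tendsto_atBot (fun s => (h.hasDerivAt_Y s).sub (hd s)) t
    (fun s _ => by
      have h1 := sechSq_pos s
      have h2 := Real.exp_pos (Z s)
      have : -(sechSq s * (m * (Real.exp (Z s) - 1))) - m * sechSq s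
        = -(sechSq s * (m * Real.exp (Z s))) := by ring
      rw [this, neg_nonpos]
      positivity) (h.tendsto_Y.sub hl)
  simp only [Pi.sub_apply] at this
  linarith

lemma Z_le (hm : 0 < m) (h : IsRegularSol m a Z Y) (t : ℝ) :
    Z t ≤ a + m * Real.log (1 + Real.exp (2 * t)) := by
  have hd : ∀ t : ℝ, HasDerivAt (fun t : ℝ => m * Real.log (1 + Real.exp (2 * t)))
      (2 * m * (1 - 1 / (1 + Real.exp (2 * t)))) t := fun t => by
    have h1 : (1 + Real.exp (2 * t)) ≠ 0 := by positivity
    refine ((((hasDerivAt_exp_two_mul t).const_add 1).log h1).const_mul m).congr_deriv ?_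
    field_simp
    ring
  have hl : Tendsto (fun t : ℝ => m * Real.log (1 + Real.exp (2 * t))) atBot (nhds 0) := by
    have := ((tendsto_exp_two_mul_atBot.const_add 1).log (by norm_num)).const_mul m
    simpa using this
  have := le_of_hasDerivAt_nonpos_of_tendsto_atBot (fun s => (h.hasDerivAt_Z s).sub (hd s)) t
    (fun s _ => by linarith [h.Y_le hm s]) (h.tendsto_Z.sub hl)
  simp only [Pi.sub_apply] at this
  linarith

/-- Zeros of a nontrivial solution are simple. -/
theorem Y_ne_zero (hm : 0 < m) (h : IsRegularSol m a Z Y) (ha : a ≠ 0) {t : ℝ} (ht : Z t = 0) :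
    Y t ≠ 0 := by
  intro hY
  apply ha
  refine tendsto_nhds_unique h.tendsto_Z (tendsto_const_nhds.congr' ?_)
  filter_upwards [eventually_le_atBot t] with s hst
  set B := max (a + m * Real.log (1 + Real.exp (2 * t))) 0 with hB
  set C := 1 + m * Real.exp B with hC
  have hCpos : 0 < C := by positivity
  have hd := fun r => (((h.hasDerivAt_Z r).pow 2).add ((h.hasDerivAt_Y r).pow 2)).mul
    (((hasDerivAt_id r).const_mul C).exp)
  have := le_of_hasDerivAt_nonneg hst hd fun r hr => by
    have hZB : Z r ≤ B := by
      refine (h.Z_le hm r).trans (le_trans ?_ (le_max_left _ _))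
      have : Real.exp (2 * r) ≤ Real.exp (2 * t) := Real.exp_le_exp.2 (by linarith [hr.2])
      have := Real.log_le_log (by positivity) (add_le_add_right this 1)
      nlinarith
    have he := abs_exp_sub_exp_le hZB (le_max_right _ _ : (0 : ℝ) ≤ B)
    rw [Real.exp_zero, sub_zero] at he
    have hq := sechSq_pos r
    have hq1 := sechSq_le_one r
    set w := sechSq r * (m * (Real.exp (Z r) - 1)) with hw
    have hwle : |w| ≤ m * Real.exp B * |Z r| := by
      rw [hw, abs_mul, abs_of_pos hq, abs_mul, abs_of_pos hm]
      have h1 : 0 ≤ m * |Real.exp (Z r) - 1| := by positivity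
      nlinarith
    have h1 : Y r * w ≤ m * Real.exp B * (|Z r| * |Y r|) := by
      have := le_abs_self (Y r * w)
      rw [abs_mul] at this
      have := mul_le_mul_of_nonneg_left hwle (abs_nonneg (Y r))
      nlinarith
    have h2 : -(|Z r| * |Y r|) ≤ Z r * Y r := by
      rw [← abs_mul]; exact neg_abs_le _
    have h3 : 2 * (|Z r| * |Y r|) ≤ Z r ^ 2 + Y r ^ 2 := by
      nlinarith [sq_nonneg (|Z r| - |Y r|), sq_abs (Z r), sq_abs (Y r)]
    have h4 : 0 ≤ |Z r| * |Y r| := by positivity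
    simp only [Pi.add_apply, Pi.pow_apply, id, mul_one, Nat.cast_ofNat, Nat.reduceSub, pow_one]
    have h5 : 0 < Real.exp (C * r) := Real.exp_pos _
    have h6 : C * (2 * (|Z r| * |Y r|)) ≤ C * (Z r ^ 2 + Y r ^ 2) :=
      mul_le_mul_of_nonneg_left h3 hCpos.le
    have h7 : 0 ≤ 2 * Z r * Y r + 2 * Y r * -w + (Z r ^ 2 + Y r ^ 2) * C := by
      rw [hC] at h6 ⊢
      nlinarith
    nlinarith
  simp only [Pi.mul_apply, Pi.add_apply, Pi.pow_apply, id, ht, hY] at this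
  have h5 : 0 < Real.exp (C * s) := Real.exp_pos _
  have h6 : Z s ^ 2 + Y s ^ 2 ≤ 0 := by
    by_contra! hcon
    have := mul_pos hcon h5
    linarith
  have h7 : Z s ^ 2 = 0 := le_antisymm (by nlinarith [sq_nonneg (Y s)]) (sq_nonneg _)
  exact (pow_eq_zero_iff two_ne_zero).1 h7 |>.symm

lemma Z_le_line (h : IsRegularSol m a Z Y) {s t θ : ℝ} (hst : s ≤ t)
    (hY : ∀ r ∈ Ioo s t, Y r ≤ θ) : Z t ≤ Z s + θ * (t - s) := by
  have := le_of_hasDerivAt_nonneg hst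
    (fun s => ((hasDerivAt_id s).const_mul θ).sub (h.hasDerivAt_Z s)) fun r hr => by
      have := hY r hr
      linarith
  simp only [Pi.sub_apply, id] at this
  linarith

lemma line_le_Z (h : IsRegularSol m a Z Y) {s t θ : ℝ} (hst : s ≤ t)
    (hY : ∀ r ∈ Ioo s t, θ ≤ Y r) : Z s + θ * (t - s) ≤ Z t := by
  have := le_of_hasDerivAt_nonneg hst
    (fun s => (h.hasDerivAt_Z s).sub ((hasDerivAt_id s).const_mul θ)) fun r hr => by
      have := hY r hr
      linarith
  simp only [Pi.sub_apply, id] at this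
  linarith

/-- A nontrivial solution has at most two zeros in the region `e^{2t} ≥ m`. -/
lemma not_three_late_zeros (hm : 0 < m) (h : IsRegularSol m a Z Y) (ha : a ≠ 0) {t₀ t₁ t₂ : ℝ}
    (h01 : t₀ < t₁) (h12 : t₁ < t₂) (h0 : Z t₀ = 0) (h1 : Z t₁ = 0)
    (hT : m ≤ Real.exp (2 * t₀)) : Z t₂ ≠ 0 := by
  have hT' : ∀ t, t₀ ≤ t → m * Real.exp (-(2 * t)) ≤ 1 := fun t ht => by
    have : Real.exp (2 * t₀) ≤ Real.exp (2 * t) := Real.exp_le_exp.2 (by linarith)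
    rw [Real.exp_neg, mul_inv_le_iff₀ (Real.exp_pos _)]
    linarith
  have hY0 : 0 < Y t₀ := by
    rcases lt_or_gt_of_ne (h.Y_ne_zero hm ha h0) with hlt | hgt
    · exact absurd h1 (h.neg_after_zero hm h0 hlt (hT' _ le_rfl) h01).ne
    · exact hgt
  obtain ⟨c, h0c, hc1, hc0, hpos⟩ :=
    exists_first_zero_of_deriv_pos h.continuous_Z h01 h0.ge (h.hasDerivAt_Z t₀) hY0 h1.le
  have hYc := deriv_nonpos_of_pos_left (h.hasDerivAt_Z c) hc0 h0c fun t ht => hpos t ht.1 ht.2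
  exact (h.neg_after_zero hm hc0 (lt_of_le_of_ne hYc (h.Y_ne_zero hm ha hc0)) (hT' _ h0c.le)
    (hc1.trans_lt h12)).ne

lemma not_two_zeros_of_pos (hm : 0 < m) (h : IsRegularSol m a Z Y) (ha : a ≠ 0) {T s t : ℝ}
    (hT : m * Real.exp (-(2 * T)) ≤ 1) (hZ : 0 < Z T) (hTs : T ≤ s) (hst : s < t)
    (hs : Z s = 0) : Z t ≠ 0 := by
  obtain ⟨c, h0c, hc1, hc0, hpos⟩ := exists_first_zero h.continuous_Z hTs hZ hs.le
  have hYc := deriv_nonpos_of_pos_left (h.hasDerivAt_Z c) hc0 h0c fun t ht => hpos t ht.1.le ht.2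
  refine (h.neg_after_zero hm hc0 (lt_of_le_of_ne hYc (h.Y_ne_zero hm ha hc0)) ?_
    (hc1.trans_lt hst)).ne
  have : Real.exp (-(2 * c)) ≤ Real.exp (-(2 * T)) := Real.exp_le_exp.2 (by linarith)
  nlinarith

lemma not_two_zeros_of_neg (hm : 0 < m) (h : IsRegularSol m a Z Y) (ha : a ≠ 0) {T s t : ℝ}
    (hT : 2 * m * Real.exp (-(2 * T)) ≤ 1 / 2) (hZ : Z T < 0) (hY : Y T ≤ 1 / 2)
    (hTs : T ≤ s) (hst : s < t) (hs : Z s = 0) : Z t ≠ 0 := by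
  obtain ⟨c, h0c, hc1, hc0, hpos⟩ :=
    exists_first_zero (f := -Z) h.continuous_Z.neg hTs (by simpa using hZ) (by simp [hs])
  simp only [Pi.neg_apply, neg_eq_zero, Left.neg_pos_iff] at hc0 hpos
  have hYc := deriv_nonpos_of_pos_left (h.hasDerivAt_Z c).neg (by simp [hc0]) h0c
    fun t ht => by simpa using hpos t ht.1.le ht.2
  have hexp : Real.exp (-(2 * c)) ≤ Real.exp (-(2 * T)) := Real.exp_le_exp.2 (by linarith)
  have hYc1 : Y c ≤ 1 := by
    have := le_of_hasDerivAt_nonneg h0c.le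
      (fun r => ((hasDerivAt_exp_neg_two_mul r).const_mul (-(2 * m))).sub (h.hasDerivAt_Y r))
      fun r hr => by
        have h1 := sechSq_le_exp_neg r
        have h2 := sechSq_pos r
        have h3 := mul_le_mul_of_nonneg_right h1 hm.le
        have h4 : 0 < sechSq r * (m * Real.exp (Z r)) := by positivity
        nlinarith
    simp only [Pi.sub_apply] at this
    have h5 : 0 < m * Real.exp (-(2 * c)) := by positivity
    nlinarith
  refine (h.pos_after_zero hm hc0 (lt_of_le_of_ne (by linarith) (h.Y_ne_zero hm ha hc0).symm) hYc1
    ?_ (hc1.trans_lt hst)).ne'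
  nlinarith

lemma exists_no_late_zeros (hm : 0 < m) (h : IsRegularSol m a Z Y) (ha : a ≠ 0) :
    ∃ T, ∀ t > T, Z t ≠ 0 := by
  obtain ⟨T, hT⟩ := (tendsto_exp_two_mul_atTop.eventually (eventually_ge_atTop m)).exists
  by_contra! hcon
  obtain ⟨t₀, h0, hz0⟩ := hcon T
  obtain ⟨t₁, h1, hz1⟩ := hcon t₀
  obtain ⟨t₂, h2, hz2⟩ := hcon t₁
  exact h.not_three_late_zeros hm ha h1 h2 hz0 hz1
    (hT.trans (Real.exp_le_exp.2 (by linarith))) hz2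

lemma eventually_pos_or_neg (hm : 0 < m) (h : IsRegularSol m a Z Y) (ha : a ≠ 0) :
    ∃ T, (∀ t > T, 0 < Z t) ∨ (∀ t > T, Z t < 0) := by
  obtain ⟨T, hT⟩ := h.exists_no_late_zeros hm ha
  refine ⟨T, ?_⟩
  by_contra! hcon
  obtain ⟨⟨s, hs, hs0⟩, t, ht, ht0⟩ := hcon
  have := (isPreconnected_Ioi (a := T)).intermediate_value hs ht h.continuous_Z.continuousOn
    ⟨hs0, ht0⟩
  obtain ⟨r, hr, hr0⟩ := this
  exact hT r hr hr0

lemma exists_slope_limit_of_pos (hm : 0 < m) (h : IsRegularSol m a Z Y) {T : ℝ}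
    (hZ : ∀ t > T, 0 < Z t) :
    ∃ σ, 0 ≤ σ ∧ Tendsto Y atTop (nhds σ) ∧ ∀ t > T, σ ≤ Y t := by
  have hanti : ∀ s t, T < s → s ≤ t → Y t ≤ Y s := fun s t hs hst =>
    h.Y_le_of_nonneg hm hst fun r hr => (hZ r (hs.trans hr.1)).le
  have hnn : ∀ t > T, 0 ≤ Y t := by
    intro t ht
    by_contra! hcon
    have hz := hZ t ht
    have hz' : 0 < Z t / -Y t := div_pos hz (by linarith)
    have h1 := h.Z_le_line (s := t) (t := t + Z t / -Y t) (by linarith)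
      fun r hr => hanti t r ht hr.1.le
    have h2 := hZ (t + Z t / -Y t) (by linarith)
    have h3 : Y t * (t + Z t / -Y t - t) = -Z t := by
      have : Y t ≠ 0 := hcon.ne
      field_simp
      ring
    linarith
  have hg : Antitone fun t => Y (max t (T + 1)) := fun s t hst =>
    hanti _ _ (by linarith [le_max_right s (T + 1)]) (max_le_max_right _ hst)
  have hb : BddBelow (range fun t => Y (max t (T + 1))) :=
    ⟨0, by rintro _ ⟨t, rfl⟩; exact hnn _ (by linarith [le_max_right t (T + 1)])⟩
  have hlim := tendsto_atTop_ciInf hg hb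
  have hlim' : Tendsto Y atTop (nhds (⨅ t, Y (max t (T + 1)))) := by
    refine hlim.congr' ?_
    filter_upwards [eventually_ge_atTop (T + 1)] with t ht
    rw [max_eq_left ht]
  refine ⟨_, le_ciInf fun t => hnn _ (by linarith [le_max_right t (T + 1)]), hlim',
    fun t ht => ?_⟩
  refine le_of_tendsto hlim' ?_
  filter_upwards [eventually_ge_atTop t] with s hs
  exact hanti t s ht hs

lemma exists_slope_limit_of_neg (hm : 0 < m) (h : IsRegularSol m a Z Y) {T : ℝ}
    (hZ : ∀ t > T, Z t < 0) :
    ∃ σ, σ ≤ 0 ∧ Tendsto Y atTop (nhds σ) ∧ ∀ t > T, Y t ≤ σ := by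
  have hmono : ∀ s t, T < s → s ≤ t → Y s ≤ Y t := fun s t hs hst =>
    h.le_Y_of_nonpos hm hst fun r hr => (hZ r (hs.trans hr.1)).le
  have hnn : ∀ t > T, Y t ≤ 0 := by
    intro t ht
    by_contra! hcon
    have hz := hZ t ht
    have hz' : 0 < -Z t / Y t := div_pos (by linarith) hcon
    have h1 := h.line_le_Z (s := t) (t := t + -Z t / Y t) (by linarith)
      fun r hr => hmono t r ht hr.1.le
    have h2 := hZ (t + -Z t / Y t) (by linarith)
    have h3 : Y t * (t + -Z t / Y t - t) = -Z t := by
      field_simp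
      ring
    linarith
  have hg : Monotone fun t => Y (max t (T + 1)) := fun s t hst =>
    hmono _ _ (by linarith [le_max_right s (T + 1)]) (max_le_max_right _ hst)
  have hb : BddAbove (range fun t => Y (max t (T + 1))) :=
    ⟨0, by rintro _ ⟨t, rfl⟩; exact hnn _ (by linarith [le_max_right t (T + 1)])⟩
  have hlim := tendsto_atTop_ciSup hg hb
  have hlim' : Tendsto Y atTop (nhds (⨆ t, Y (max t (T + 1)))) := by
    refine hlim.congr' ?_
    filter_upwards [eventually_ge_atTop (T + 1)] with t ht
    rw [max_eq_left ht]
  refine ⟨_, ciSup_le fun t => hnn _ (by linarith [le_max_right t (T + 1)]), hlim',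
    fun t ht => ?_⟩
  refine ge_of_tendsto hlim' ?_
  filter_upwards [eventually_ge_atTop t] with s hs
  exact hmono t s ht hs

lemma slope_limit_lt_two (hm : 0 < m) (h : IsRegularSol m a Z Y) {T σ : ℝ}
    (hZ : ∀ t > T, 0 < Z t) (hY : ∀ t > T, σ ≤ Y t) : σ < 2 := by
  by_contra! hσ
  set S := max T 0 + 1 with hS
  have hST : T < S := by linarith [le_max_left T 0]
  have hS0 : 0 < S := by linarith [le_max_right T 0]
  set c := m * Real.exp (Z S - 2 * S) with hc
  have hcpos : 0 < c := by positivity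
  have key : ∀ t, S ≤ t → Y t ≤ Y S + m / 2 * Real.exp (-(2 * S)) - c * (t - S) := fun t ht => by
    have := le_of_hasDerivAt_nonneg ht
      (fun r => (((hasDerivAt_exp_neg_two_mul r).const_mul (-(m / 2))).sub (h.hasDerivAt_Y r)).sub
        ((hasDerivAt_id r).const_mul c))
      fun r hr => by
        have hline := h.line_le_Z (s := S) (t := r) (θ := 2) hr.1.le
          fun s hs => hσ.trans (hY s (hST.trans hs.1))
        have h1 := exp_neg_le_sechSq (hS0.trans hr.1).le
        have h2 := Real.one_le_exp (hZ r (hST.trans hr.1)).le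
        have h3 : Real.exp (-(2 * r)) * (m * (Real.exp (Z r) - 1))
            ≤ sechSq r * (m * (Real.exp (Z r) - 1)) :=
          mul_le_mul_of_nonneg_right h1 (mul_nonneg hm.le (by linarith))
        have h4 : c ≤ m * (Real.exp (-(2 * r)) * Real.exp (Z r)) := by
          rw [← Real.exp_add, hc]
          exact mul_le_mul_of_nonneg_left (Real.exp_le_exp.2 (by linarith)) hm.le
        simp only [mul_one]
        nlinarith
    simp only [Pi.sub_apply, id] at this
    have h5 : 0 < m / 2 * Real.exp (-(2 * t)) := by positivity
    linarith
  have hYS : 2 ≤ Y S := hσ.trans (hY S hST)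
  have hpos : 0 < (Y S + m / 2 * Real.exp (-(2 * S))) / c := by positivity
  have h1 := key (S + (Y S + m / 2 * Real.exp (-(2 * S))) / c) (by linarith)
  have h2 := hY (S + (Y S + m / 2 * Real.exp (-(2 * S))) / c) (by linarith)
  rw [add_sub_cancel_left, mul_div_cancel₀ _ hcpos.ne'] at h1
  linarith

/-- Positive limiting slope: the positivity barrier holds at all late times. -/
lemma eventually_slopeBarrier_lt (hm : 0 < m) (h : IsRegularSol m a Z Y) {T σ : ℝ}
    (hZ : ∀ t > T, 0 < Z t) (hσ : 0 < σ) (hlim : Tendsto Y atTop (nhds σ))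
    (hY : ∀ t > T, σ ≤ Y t) :
    ∀ᶠ t in atTop, 0 < Z t ∧ 0 < Y t ∧ Y t < 2 ∧ slopeBarrier m t (Z t) (Y t) t < Y t := by
  have hσ2 := h.slope_limit_lt_two hm hZ hY
  obtain ⟨θ, hθ1, hθ2⟩ := exists_between hσ2
  obtain ⟨S, hS⟩ := eventually_atTop.1 (hlim.eventually (gt_mem_nhds hθ1))
  have hsmall : Tendsto (fun t => 4 * m / (2 - θ) * Real.exp (Z S - θ * S - (2 - θ) * t)) atTop
      (nhds 0) := by
    have h1 : Tendsto (fun t : ℝ => Z S - θ * S - (2 - θ) * t) atTop atBot :=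
      tendsto_atBot_add_const_left _ _
        (tendsto_neg_atTop_atBot.comp (tendsto_id.const_mul_atTop (by linarith)))
    simpa using (Real.tendsto_exp_atBot.comp h1).const_mul (4 * m / (2 - θ))
  filter_upwards [eventually_gt_atTop T, eventually_ge_atTop S,
    hsmall.eventually (gt_mem_nhds hσ)] with t htT htS hts
  have hYt := hS t htS
  have hσY := hY t htT
  refine ⟨hZ t htT, hσ.trans_le hσY, hYt.trans hθ2, lt_of_lt_of_le ?_ hσY⟩
  refine lt_of_le_of_lt ?_ hts
  have hline := h.Z_le_line htS fun r hr => (hS r hr.1.le).le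
  rw [slopeBarrier, sub_self, mul_zero, add_zero]
  have h1 : Real.exp (Z t - 2 * t) / (2 - Y t)
      ≤ Real.exp (Z S - θ * S - (2 - θ) * t) / (2 - θ) := by
    refine div_le_div₀ (Real.exp_pos _).le (Real.exp_le_exp.2 (by linarith)) (by linarith)
      (by linarith)
  have h2 : 0 < m * Real.exp (-(2 * t)) := by positivity
  have h3 := mul_le_mul_of_nonneg_left h1 (by positivity : 0 ≤ 4 * m)
  have h4 : 4 * m / (2 - θ) * Real.exp (Z S - θ * S - (2 - θ) * t)
      = 4 * m * (Real.exp (Z S - θ * S - (2 - θ) * t) / (2 - θ)) := by ring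
  rw [h4]
  nlinarith

end IsRegularSol

/-- Negative limiting slope: the negativity barrier holds at all late times. -/
lemma eventually_slope_lt (m : ℝ) {Z Y : ℝ → ℝ} {T σ : ℝ}
    (hZ : ∀ t > T, Z t < 0) (hσ : σ < 0) (hY : ∀ t > T, Y t ≤ σ) :
    ∀ᶠ t in atTop, Z t < 0 ∧ Y t < -(2 * (m * Real.exp (-(2 * t)))) := by
  have h1 := ((tendsto_exp_neg_two_mul_atTop.const_mul m).const_mul 2).neg
  simp only [mul_zero, neg_zero] at h1
  filter_upwards [eventually_gt_atTop T, h1.eventually (lt_mem_nhds hσ)] with t ht hts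
  exact ⟨hZ t ht, (hY t ht).trans_lt hts⟩

/-- `f` has at least `n` distinct zeros. -/
def HasZeros (f : ℝ → ℝ) (n : ℕ) : Prop := ∃ t : Fin n → ℝ, StrictMono t ∧ ∀ i, f (t i) = 0

lemma HasZeros.mono {f : ℝ → ℝ} {n k : ℕ} (h : HasZeros f n) (hk : k ≤ n) : HasZeros f k := by
  obtain ⟨t, ht, h0⟩ := h
  exact ⟨fun i => t (Fin.castLE hk i), ht.comp (Fin.strictMono_castLE hk), fun i => h0 _⟩

/-- A family of solutions with `Z a (-∞) = min a A`, Lipschitz in `a` on left half-lines. -/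
structure IsSolFamily (m A : ℝ) (Z Y : ℝ → ℝ → ℝ) : Prop where
  pos_m : 0 < m
  pos_A : 0 < A
  sol : ∀ a, IsRegularSol m (min a A) (Z a) (Y a)
  lipschitz_Z : ∀ T, ∃ C, ∀ t ≤ T, ∀ a a', |Z a t - Z a' t| ≤ C * |a - a'|
  lipschitz_Y : ∀ T, ∃ C, ∀ t ≤ T, ∀ a a', |Y a t - Y a' t| ≤ C * |a - a'|
  zero_Z : ∀ t, Z 0 t = 0

lemma eventually_mul_neg_of_hasDerivAt_pos {f : ℝ → ℝ} {f' c : ℝ} (hf : HasDerivAt f f' c)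
    (h0 : f c = 0) (h : 0 < f') : ∀ᶠ δ in nhdsWithin 0 (Ioi 0), f (c - δ) * f (c + δ) < 0 := by
  obtain ⟨d, hd, hd'⟩ := exists_gt_pos_of_hasDerivAt_pos hf h0.ge h
  obtain ⟨e, he, he'⟩ := exists_lt_neg_of_hasDerivAt_pos hf h0.le h
  have hmin : 0 < min (d - c) (c - e) := lt_min (sub_pos.2 hd) (sub_pos.2 he)
  filter_upwards [Ioo_mem_nhdsGT hmin] with δ hδ
  have h1 := hδ.2.trans_le (min_le_left _ _)
  have h2 := hδ.2.trans_le (min_le_right _ _)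
  have h3 := hδ.1
  exact mul_neg_of_neg_of_pos (he' _ ⟨by linarith, by linarith⟩) (hd' _ ⟨by linarith, by linarith⟩)

lemma eventually_mul_neg_of_hasDerivAt_ne_zero {f : ℝ → ℝ} {f' c : ℝ} (hf : HasDerivAt f f' c)
    (h0 : f c = 0) (h : f' ≠ 0) : ∀ᶠ δ in nhdsWithin 0 (Ioi 0), f (c - δ) * f (c + δ) < 0 := by
  rcases lt_or_gt_of_ne h with h | h
  · have := eventually_mul_neg_of_hasDerivAt_pos hf.neg (by simp [h0]) (neg_pos.2 h)
    simpa using this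
  · exact eventually_mul_neg_of_hasDerivAt_pos hf h0 h

lemma exists_zero_of_mul_neg {f : ℝ → ℝ} (hf : Continuous f) {a b : ℝ} (hab : a ≤ b)
    (h : f a * f b < 0) : ∃ c ∈ Icc a b, f c = 0 := by
  rcases mul_neg_iff.1 h with ⟨h1, h2⟩ | ⟨h1, h2⟩
  · exact intermediate_value_Icc' hab hf.continuousOn ⟨h2.le, h1.le⟩
  · exact intermediate_value_Icc hab hf.continuousOn ⟨h1.le, h2.le⟩

lemma tendsto_of_locally_lipschitz {F : ℝ → ℝ → ℝ} {a x : ℝ} (hc : ContinuousAt (F a) x)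
    (hl : ∀ T, ∃ C, ∀ t ≤ T, ∀ a a', |F a t - F a' t| ≤ C * |a - a'|) {b t : ℕ → ℝ}
    (hb : Tendsto b atTop (nhds a)) (ht : Tendsto t atTop (nhds x)) :
    Tendsto (fun j => F (b j) (t j)) atTop (nhds (F a x)) := by
  obtain ⟨C, hC⟩ := hl (x + 1)
  have h1 : Tendsto (fun j => F a (t j)) atTop (nhds (F a x)) := hc.tendsto.comp ht
  have h2 : Tendsto (fun j => C * |b j - a|) atTop (nhds 0) := by
    have := ((hb.sub_const a).abs).const_mul C
    simpa using this
  have h3 : Tendsto (fun j => F (b j) (t j) - F a (t j)) atTop (nhds 0) := by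
    refine squeeze_zero_norm' ?_ h2
    filter_upwards [ht.eventually (gt_mem_nhds (lt_add_one x))] with j hj
    exact hC _ hj.le _ _
  simpa using h3.add h1

lemma continuous_of_lipschitz_param {F : ℝ → ℝ → ℝ}
    (hl : ∀ T, ∃ C, ∀ t ≤ T, ∀ a a', |F a t - F a' t| ≤ C * |a - a'|) (t : ℝ) :
    Continuous fun a => F a t := by
  obtain ⟨C, hC⟩ := hl t
  refine (LipschitzWith.of_dist_le_mul (K := C.toNNReal) fun a b => ?_).continuous
  rw [Real.dist_eq, Real.dist_eq]
  refine (hC t le_rfl a b).trans (mul_le_mul_of_nonneg_right ?_ (abs_nonneg _))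
  exact Real.le_coe_toNNReal C

namespace IsSolFamily

variable {m A : ℝ} {Z Y : ℝ → ℝ → ℝ}

lemma min_ne_zero (F : IsSolFamily m A Z Y) {a : ℝ} (ha : a ≠ 0) : min a A ≠ 0 := by
  have := F.pos_A
  rcases le_total a A with h | h
  · rwa [min_eq_left h]
  · rw [min_eq_right h]; exact this.ne'

lemma Y_ne_zero (F : IsSolFamily m A Z Y) {a t : ℝ} (ha : a ≠ 0) (ht : Z a t = 0) : Y a t ≠ 0 :=
  (F.sol a).Y_ne_zero F.pos_m (F.min_ne_zero ha) ht

lemma continuous_Z_param (F : IsSolFamily m A Z Y) (t : ℝ) : Continuous fun a => Z a t :=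
  continuous_of_lipschitz_param F.lipschitz_Z t

lemma continuous_Y_param (F : IsSolFamily m A Z Y) (t : ℝ) : Continuous fun a => Y a t :=
  continuous_of_lipschitz_param F.lipschitz_Y t

lemma eventually_hasZeros (F : IsSolFamily m A Z Y) {a : ℝ} (ha : a ≠ 0) {n : ℕ}
    (h : HasZeros (Z a) n) : ∀ᶠ b in nhds a, HasZeros (Z b) n := by
  obtain ⟨t, ht, h0⟩ := h
  have h1 : ∀ᶠ δ : ℝ in nhdsWithin 0 (Ioi 0), ∀ i, Z a (t i - δ) * Z a (t i + δ) < 0 :=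
    eventually_all.2 fun i => eventually_mul_neg_of_hasDerivAt_ne_zero
      ((F.sol a).hasDerivAt_Z (t i)) (h0 i) (F.Y_ne_zero ha (h0 i))
  have h2 : ∀ᶠ δ : ℝ in nhdsWithin 0 (Ioi 0), ∀ i j, i < j → t i + δ < t j - δ := by
    refine eventually_all.2 fun i => eventually_all.2 fun j => ?_
    by_cases hij : i < j
    · have := ht hij
      filter_upwards [Ioo_mem_nhdsGT (half_pos (sub_pos.2 this))] with δ hδ _
      linarith [hδ.2]
    · exact Eventually.of_forall fun _ h => absurd h hij
  obtain ⟨δ, ⟨h1, h2⟩, hδ⟩ := ((h1.and h2).and self_mem_nhdsWithin).exists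
  have hδ : 0 < δ := hδ
  have h3 : ∀ᶠ b in nhds a, ∀ i, Z b (t i - δ) * Z b (t i + δ) < 0 :=
    eventually_all.2 fun i => ((F.continuous_Z_param _).mul
      (F.continuous_Z_param _)).continuousAt.eventually (gt_mem_nhds (h1 i))
  filter_upwards [h3] with b hb
  choose s hs hs0 using fun i =>
    exists_zero_of_mul_neg (F.sol b).continuous_Z (by linarith : t i - δ ≤ t i + δ) (hb i)
  exact ⟨s, fun i j hij => by linarith [(hs i).2, (hs j).1, h2 i j hij], hs0⟩

/-- Zeros cannot escape to `-∞`. -/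
lemma exists_lower_bound (F : IsSolFamily m A Z Y) {a : ℝ} (ha : a ≠ 0) :
    ∃ S, ∀ᶠ b in nhds a, ∀ t ≤ S, Z b t ≠ 0 := by
  have hα := F.min_ne_zero ha
  have h1 := ((F.sol a).tendsto_Z.abs).eventually (lt_mem_nhds (half_lt_self (abs_pos.2 hα)))
  obtain ⟨S, hS⟩ := eventually_atBot.1 h1
  obtain ⟨C, hC⟩ := F.lipschitz_Z S
  refine ⟨S, ?_⟩
  have h2 : Tendsto (fun b => C * |b - a|) (nhds a) (nhds 0) := by
    have : Continuous fun b => C * |b - a| := by fun_prop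
    simpa using this.tendsto a
  filter_upwards [h2.eventually (gt_mem_nhds (half_pos (abs_pos.2 hα)))] with b hb t ht h0
  have h3 := hC t ht b a
  rw [h0, zero_sub, abs_neg] at h3
  linarith [hS t ht]

/-- Zeros in a left half-line persist in the limit. -/
lemma hasZeros_of_frequently (F : IsSolFamily m A Z Y) {a T : ℝ} (ha : a ≠ 0) {n : ℕ}
    (h : ∃ᶠ b in nhds a, ∃ t : Fin n → ℝ, StrictMono t ∧ ∀ i, t i ≤ T ∧ Z b (t i) = 0) :
    HasZeros (Z a) n := by
  obtain ⟨S, hS⟩ := F.exists_lower_bound ha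
  obtain ⟨b, hb, hbt⟩ := exists_seq_forall_of_frequently (h.and_eventually hS)
  choose t ht using fun j => (hbt j).1
  have hmem : ∀ j, t j ∈ Set.pi univ fun _ : Fin n => Icc S T := fun j i _ =>
    ⟨by
      by_contra! hcon
      exact (hbt j).2 _ hcon.le ((ht j).2 i).2, ((ht j).2 i).1⟩
  obtain ⟨τ, -, φ, hφ, hlim⟩ :=
    (isCompact_univ_pi fun _ : Fin n => isCompact_Icc (a := S) (b := T)).tendsto_subseq hmem
  have hlim' := tendsto_pi_nhds.1 hlim
  have hb' := hb.comp hφ.tendsto_atTop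
  have hz : ∀ i, Z a (τ i) = 0 := fun i => by
    refine tendsto_nhds_unique (tendsto_of_locally_lipschitz
      (F.sol a).continuous_Z.continuousAt F.lipschitz_Z hb' (hlim' i)) ?_
    refine tendsto_const_nhds.congr fun j => ?_
    exact ((ht (φ j)).2 i).2.symm
  refine ⟨τ, fun i k hik => ?_, hz⟩
  have hle : τ i ≤ τ k := le_of_tendsto_of_tendsto' (hlim' i) (hlim' k)
    fun j => ((ht (φ j)).1 hik).le
  refine lt_of_le_of_ne hle fun heq => F.Y_ne_zero ha (hz i) ?_
  have hrolle : ∀ j, ∃ c ∈ Ioo (t (φ j) i) (t (φ j) k), Y (b (φ j)) c = 0 := fun j =>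
    exists_hasDerivAt_eq_zero ((ht (φ j)).1 hik)
      (F.sol _).continuous_Z.continuousOn
      (by rw [((ht (φ j)).2 i).2, ((ht (φ j)).2 k).2]) fun c _ => (F.sol _).hasDerivAt_Z c
  choose c hc hc0 using hrolle
  have hclim : Tendsto c atTop (nhds (τ i)) :=
    tendsto_of_tendsto_of_tendsto_of_le_of_le (hlim' i) (heq ▸ hlim' k)
      (fun j => (hc j).1.le) fun j => (hc j).2.le
  refine tendsto_nhds_unique (tendsto_of_locally_lipschitz
    (F.sol a).continuous_Y.continuousAt F.lipschitz_Y hb' hclim) ?_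
  exact tendsto_const_nhds.congr fun j => (hc0 j).symm

/-- At most one zero can escape to `+∞`. -/
lemma exists_at_most_one_late_zero (F : IsSolFamily m A Z Y) {a : ℝ} (ha : a ≠ 0) :
    ∃ T, ∀ᶠ b in nhds a, ∀ s t, T ≤ s → s < t → Z b s = 0 → Z b t ≠ 0 := by
  have hm := F.pos_m
  obtain ⟨T₀, h⟩ := (F.sol a).eventually_pos_or_neg hm (F.min_ne_zero ha)
  have hsmall := (tendsto_exp_neg_two_mul_atTop.const_mul (2 * m)).eventually
    (gt_mem_nhds (by norm_num : 2 * m * 0 < 1 / 2))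
  have hb0 : ∀ᶠ b : ℝ in nhds a, b ≠ 0 := isOpen_ne.mem_nhds ha
  rcases h with h | h
  · obtain ⟨T, hT, hT0⟩ := (hsmall.and (eventually_gt_atTop T₀)).exists
    refine ⟨T, ?_⟩
    filter_upwards [hb0, (F.continuous_Z_param T).continuousAt.eventually (lt_mem_nhds (h T hT0))]
      with b hb hbT s t hs hst hs0
    exact (F.sol b).not_two_zeros_of_pos hm (F.min_ne_zero hb) (by linarith) hbT hs hst hs0
  · obtain ⟨σ, hσ, -, hY⟩ := (F.sol a).exists_slope_limit_of_neg hm h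
    obtain ⟨T, hT, hT0⟩ := (hsmall.and (eventually_gt_atTop T₀)).exists
    refine ⟨T, ?_⟩
    filter_upwards [hb0, (F.continuous_Z_param T).continuousAt.eventually (gt_mem_nhds (h T hT0)),
      (F.continuous_Y_param T).continuousAt.eventually
        (gt_mem_nhds (((hY T hT0).trans hσ).trans_lt one_half_pos))]
      with b hb hbT hbY s t hs hst hs0
    exact (F.sol b).not_two_zeros_of_neg hm (F.min_ne_zero hb) hT.le hbT hbY.le hs hst hs0

lemma continuousAt_slopeBarrier (F : IsSolFamily m A Z Y) {a T : ℝ} (h : Y a T < 2) :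
    ContinuousAt (fun b => slopeBarrier m T (Z b T) (Y b T) T) a := by
  have h1 := (F.continuous_Z_param T).continuousAt (x := a)
  have h2 := (F.continuous_Y_param T).continuousAt (x := a)
  unfold slopeBarrier
  refine ContinuousAt.mul continuousAt_const (ContinuousAt.sub (ContinuousAt.div ?_ ?_ ?_)
    continuousAt_const)
  · refine ContinuousAt.rexp ?_
    exact (h1.sub continuousAt_const).add ((h2.sub continuousAt_const).mul continuousAt_const)
  · exact continuousAt_const.sub h2
  · linarith

/-- The slope has a limit at `+∞`, and no zero escapes if that limit is not zero. -/
lemma tendsto_slope_or_no_late_zero (F : IsSolFamily m A Z Y) {a : ℝ} (ha : a ≠ 0) :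
    Tendsto (Y a) atTop (nhds 0) ∨ ∃ T, ∀ᶠ b in nhds a, ∀ t > T, Z b t ≠ 0 := by
  have hm := F.pos_m
  obtain ⟨T₀, h⟩ := (F.sol a).eventually_pos_or_neg hm (F.min_ne_zero ha)
  rcases h with h | h
  · obtain ⟨σ, hσ, hlim, hY⟩ := (F.sol a).exists_slope_limit_of_pos hm h
    rcases hσ.eq_or_lt with rfl | hσ
    · exact Or.inl hlim
    obtain ⟨T, hT1, hT2, hT3, hT4⟩ :=
      ((F.sol a).eventually_slopeBarrier_lt hm h hσ hlim hY).exists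
    refine Or.inr ⟨T, ?_⟩
    filter_upwards [(F.continuous_Z_param T).continuousAt.eventually (lt_mem_nhds hT1),
      (F.continuous_Y_param T).continuousAt.eventually (lt_mem_nhds hT2),
      (F.continuous_Y_param T).continuousAt.eventually (gt_mem_nhds hT3),
      (F.continuousAt_slopeBarrier hT3).eventually_lt (F.continuous_Y_param T).continuousAt hT4]
      with b h1 h2 h3 h4 t ht
    exact ((F.sol b).pos_of_slopeBarrier_lt hm h1.le h2 h3 h4 ht).ne'
  · obtain ⟨σ, hσ, hlim, hY⟩ := (F.sol a).exists_slope_limit_of_neg hm h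
    rcases hσ.eq_or_lt with rfl | hσ
    · exact Or.inl hlim
    obtain ⟨T, hT1, hT2⟩ := (eventually_slope_lt m h hσ hY).exists
    refine Or.inr ⟨T, ?_⟩
    filter_upwards [(F.continuous_Z_param T).continuousAt.eventually (gt_mem_nhds hT1),
      (F.continuous_Y_param T).continuousAt.eventually (gt_mem_nhds hT2)] with b h1 h2 t ht
    exact ((F.sol b).neg_of_slope_lt hm h1.le h2 ht).ne

/-- Where the number of zeros jumps, the solution has vanishing limiting slope. -/
theorem exists_tendsto_slope_zero (F : IsSolFamily m A Z Y) {p s : ℝ} (h0 : (0 : ℝ) ∉ uIcc p s)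
    {n : ℕ} (hs : HasZeros (Z s) (n + 1)) (hp : ¬ HasZeros (Z p) (n + 1)) :
    ∃ a ∈ uIcc p s, HasZeros (Z a) n ∧ ¬ HasZeros (Z a) (n + 1) ∧
      Tendsto (Y a) atTop (nhds 0) := by
  have hjump : ∃ a ∈ uIcc p s, ¬ HasZeros (Z a) (n + 1) ∧
      ∃ᶠ b in nhds a, HasZeros (Z b) (n + 1) := by
    by_contra! hcon
    have hne : ∀ a ∈ uIcc p s, a ≠ 0 := fun a ha h => h0 (h ▸ ha)
    have hsub : uIcc p s ⊆ interior {a | HasZeros (Z a) (n + 1)} ∪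
        interior {a | ¬ HasZeros (Z a) (n + 1)} := fun a ha => by
      by_cases hz : HasZeros (Z a) (n + 1)
      · exact Or.inl (mem_interior_iff_mem_nhds.2 (F.eventually_hasZeros (hne a ha) hz))
      · exact Or.inr (mem_interior_iff_mem_nhds.2 (hcon a ha hz))
    have hs' : s ∈ interior {a | HasZeros (Z a) (n + 1)} :=
      (hsub right_mem_uIcc).resolve_right fun h => interior_subset h hs
    have hp' : p ∈ interior {a | ¬ HasZeros (Z a) (n + 1)} :=
      (hsub left_mem_uIcc).resolve_left fun h => hp (show p ∈ {a | HasZeros (Z a) (n + 1)} from interior_subset h)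
    obtain ⟨a, -, ha1, ha2⟩ := isPreconnected_uIcc _ _ isOpen_interior isOpen_interior hsub
      ⟨s, right_mem_uIcc, hs'⟩ ⟨p, left_mem_uIcc, hp'⟩
    exact interior_subset ha2 (show a ∈ {a | HasZeros (Z a) (n + 1)} from interior_subset ha1)
  obtain ⟨a, ha, hna, hfreq⟩ := hjump
  have ha0 : a ≠ 0 := fun h => h0 (h ▸ ha)
  refine ⟨a, ha, ?_, hna, ?_⟩
  · obtain ⟨T, hT⟩ := F.exists_at_most_one_late_zero ha0
    refine F.hasZeros_of_frequently (T := T) ha0 ((hfreq.and_eventually hT).mono ?_)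
    rintro b ⟨⟨t, ht, ht0⟩, hb⟩
    refine ⟨fun i => t i.castSucc, ht.comp Fin.strictMono_castSucc, fun i => ⟨?_, ht0 _⟩⟩
    by_contra! hcon
    exact hb _ _ hcon.le (ht (Fin.castSucc_lt_last i)) (ht0 _) (ht0 _)
  · refine (F.tendsto_slope_or_no_late_zero ha0).resolve_right ?_
    rintro ⟨T, hT⟩
    refine hna (F.hasZeros_of_frequently (T := T) ha0 ((hfreq.and_eventually hT).mono ?_))
    rintro b ⟨⟨t, ht, ht0⟩, hb⟩
    refine ⟨t, ht, fun i => ⟨?_, ht0 _⟩⟩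
    by_contra! hcon
    exact hb _ hcon (ht0 _)

end IsSolFamily

namespace IsRegularSol

variable {m a : ℝ} {Z Y : ℝ → ℝ}

lemma not_hasZeros_three (hm : 0 < m) (h : IsRegularSol m a Z Y) (ha : a ≠ 0)
    (hz : ∀ t, Real.exp (2 * t) < m → Z t ≠ 0) : ¬ HasZeros Z 3 := by
  rintro ⟨t, ht, h0⟩
  have h01 : t 0 < t 1 := ht (by decide)
  have h12 : t 1 < t 2 := ht (by decide)
  refine h.not_three_late_zeros hm ha h01 h12 (h0 _) (h0 _) ?_ (h0 _)
  by_contra! hcon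
  exact hz _ hcon (h0 _)

lemma not_hasZeros_four (hm : 0 < m) (h : IsRegularSol m a Z Y) (ha : a ≠ 0)
    (hz : ∀ s t, s < t → Real.exp (2 * t) < m → Z s = 0 → Z t ≠ 0) : ¬ HasZeros Z 4 := by
  rintro ⟨t, ht, h0⟩
  have h01 : t 0 < t 1 := ht (by decide)
  have h12 : t 1 < t 2 := ht (by decide)
  have h23 : t 2 < t 3 := ht (by decide)
  refine h.not_three_late_zeros hm ha h12 h23 (h0 _) (h0 _) ?_ (h0 _)
  by_contra! hcon
  exact hz _ _ h01 hcon (h0 _) (h0 _)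

lemma not_hasZeros_three_of_le (hm : 0 < m) (h : IsRegularSol m a Z Y)
    (ha : a < -(m * Real.log (1 + m))) : ¬ HasZeros Z 3 := by
  have hlog : 0 < m * Real.log (1 + m) := mul_pos hm (Real.log_pos (by linarith))
  refine h.not_hasZeros_three hm (by linarith) fun t ht => ne_of_lt ?_
  have h1 := h.Z_le hm t
  have h2 := Real.log_le_log (by positivity) (add_le_add_right ht.le 1)
  have h3 := mul_le_mul_of_nonneg_left h2 hm.le
  linarith

/-- Minus the slope of the underlying solution `Z - m log (1 + e^{2t})`. -/
def decay (m : ℝ) (Y : ℝ → ℝ) (t : ℝ) : ℝ := 2 * m * (1 - 1 / (1 + Real.exp (2 * t))) - Y t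

lemma hasDerivAt_decay (h : IsRegularSol m a Z Y) (t : ℝ) :
    HasDerivAt (decay m Y) (m * sechSq t * Real.exp (Z t)) t := by
  have h1 : (1 + Real.exp (2 * t)) ≠ 0 := by positivity
  refine (((((hasDerivAt_const t (1 : ℝ)).div ((hasDerivAt_exp_two_mul t).const_add 1)
    h1).const_sub 1).const_mul (2 * m)).sub (h.hasDerivAt_Y t)).congr_deriv ?_
  rw [sechSq]
  field_simp
  ring

lemma tendsto_decay (h : IsRegularSol m a Z Y) : Tendsto (decay m Y) atBot (nhds 0) := by
  have := ((((tendsto_const_nhds (x := (1 : ℝ))).div (tendsto_exp_two_mul_atBot.const_add 1)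
      (by norm_num)).const_sub 1).const_mul (2 * m)).sub h.tendsto_Y
  have h0 : 2 * m * (1 - 1 / (1 + 0)) - 0 = 0 := by norm_num
  rwa [h0] at this

lemma decay_pos (hm : 0 < m) (h : IsRegularSol m a Z Y) (t : ℝ) : 0 < decay m Y t := by
  have h1 : decay m Y (t - 1) < decay m Y t :=
    lt_of_hasDerivAt_pos (by linarith) h.hasDerivAt_decay fun r _ => by
      have := sechSq_pos r
      positivity
  have h2 := h.Y_le hm (t - 1)
  have h3 : 0 ≤ decay m Y (t - 1) := by unfold decay; linarith
  exact h3.trans_lt h1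

lemma _root_.hasDerivAt_sechSq (t : ℝ) :
    HasDerivAt sechSq (sechSq t * (2 - 4 * (1 - 1 / (1 + Real.exp (2 * t))))) t := by
  have h1 : (1 + Real.exp (2 * t)) ≠ 0 := by positivity
  refine ((((hasDerivAt_exp_two_mul t).const_mul 4).div
    (((hasDerivAt_exp_two_mul t).const_add 1).pow 2) (pow_ne_zero 2 h1))).congr_deriv ?_
  simp only [sechSq, Nat.cast_ofNat, Nat.reduceSub, pow_one, Pi.pow_apply]
  field_simp
  ring

lemma _root_.tendsto_sechSq_atBot : Tendsto sechSq atBot (nhds 0) := by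
  have := (tendsto_exp_two_mul_atBot.const_mul 4).div
    ((tendsto_exp_two_mul_atBot.const_add 1).pow 2) (by norm_num)
  rwa [mul_zero, zero_div] at this

/-- The logistic inequality for the decay rate. -/
lemma decay_mul_le (hm : 2 < m) (h : IsRegularSol m a Z Y) (t : ℝ) :
    decay m Y t * (4 - decay m Y t) / 2 ≤ m * sechSq t * Real.exp (Z t) := by
  have hd := fun s => (((h.hasDerivAt_decay s).const_mul 2).sub
    (((h.hasDerivAt_decay s).pow 2).div_const 2)).sub
      (((hasDerivAt_sechSq s).const_mul m).mul (h.hasDerivAt_Z s).exp)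
  have hl : Tendsto (((fun s => 2 * decay m Y s) - fun s => (decay m Y ^ 2) s / 2) -
      (fun s => m * sechSq s) * fun s => Real.exp (Z s)) atBot
      (nhds ((2 * 0 - 0 ^ 2 / 2) - (m * 0) * Real.exp a)) :=
    ((h.tendsto_decay.const_mul 2).sub ((h.tendsto_decay.pow 2).div_const 2)).sub
      ((tendsto_sechSq_atBot.const_mul m).mul ((Real.continuous_exp.tendsto a).comp h.tendsto_Z))
  have := le_of_hasDerivAt_nonpos_of_tendsto_atBot hd t (fun s _ => by
    have hE : 0 < m * sechSq s * Real.exp (Z s) := by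
      have := sechSq_pos s
      positivity
    have hx : 0 ≤ 1 - 1 / (1 + Real.exp (2 * s)) := by
      rw [sub_nonneg, div_le_one (by positivity)]
      linarith [Real.exp_pos (2 * s)]
    have hY : Y s = 2 * m * (1 - 1 / (1 + Real.exp (2 * s))) - decay m Y s := by
      unfold decay; ring
    simp only [Nat.cast_ofNat, Nat.reduceSub, pow_one]
    rw [hY]
    have : 0 ≤ (m * sechSq s * Real.exp (Z s)) * ((2 * m - 4) * (1 - 1 / (1 + Real.exp (2 * s)))) :=
      mul_nonneg hE.le (mul_nonneg (by linarith) hx)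
    nlinarith) hl
  simp only [Pi.sub_apply, Pi.mul_apply, Pi.pow_apply] at this
  linarith

lemma hasDerivAt_sub_log (h : IsRegularSol m a Z Y) (t : ℝ) :
    HasDerivAt (fun t => Z t - m * Real.log (1 + Real.exp (2 * t))) (-decay m Y t) t := by
  have h1 : (1 + Real.exp (2 * t)) ≠ 0 := by positivity
  refine ((h.hasDerivAt_Z t).sub
    ((((hasDerivAt_exp_two_mul t).const_add 1).log h1).const_mul m)).congr_deriv ?_
  rw [decay]
  field_simp
  ring

lemma tendsto_sub_log (h : IsRegularSol m a Z Y) :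
    Tendsto (fun t => Z t - m * Real.log (1 + Real.exp (2 * t))) atBot (nhds a) := by
  have := h.tendsto_Z.sub
    (((tendsto_exp_two_mul_atBot.const_add 1).log (by norm_num)).const_mul m)
  simpa using this

lemma le_decay (hm : 2 < m) (h : IsRegularSol m a Z Y) (t : ℝ) :
    2 * m * Real.exp (Z t - m * Real.log (1 + Real.exp (2 * t))) * Real.exp (2 * t)
      ≤ decay m Y t := by
  set c := Real.exp (Z t - m * Real.log (1 + Real.exp (2 * t))) with hc
  have hl : Tendsto ((fun s => 2 * m * c * Real.exp (2 * s)) - decay m Y) atBot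
      (nhds (2 * m * c * 0 - 0)) :=
    (tendsto_exp_two_mul_atBot.const_mul (2 * m * c)).sub h.tendsto_decay
  have := le_of_hasDerivAt_nonpos_of_tendsto_atBot
    (fun s => ((hasDerivAt_exp_two_mul s).const_mul (2 * m * c)).sub (h.hasDerivAt_decay s)) t
    (fun s hst => by
      have hmono := le_of_hasDerivAt_nonneg hst.le (fun r => (h.hasDerivAt_sub_log r).neg)
        fun r _ => by rw [neg_neg]; exact (h.decay_pos (by linarith) r).le
      simp only [Pi.neg_apply, neg_le_neg_iff] at hmono
      have h1 : c ≤ Real.exp (Z s - m * Real.log (1 + Real.exp (2 * s))) :=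
        Real.exp_le_exp.2 hmono
      set w := 1 + Real.exp (2 * s) with hw
      have hw1 : 1 < w := by linarith [Real.exp_pos (2 * s)]
      have h2 : Real.exp (Z s - m * Real.log w) * w ^ 2 ≤ Real.exp (Z s) := by
        have : w ^ 2 = Real.exp (2 * Real.log w) := by
          rw [mul_comm, Real.exp_mul, Real.exp_log (by linarith)]
          norm_num
        rw [this, ← Real.exp_add]
        refine Real.exp_le_exp.2 ?_
        have := Real.log_pos hw1
        nlinarith
      have h3 : c ≤ Real.exp (Z s) / w ^ 2 := by
        rw [le_div_iff₀ (by positivity)]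
        exact (mul_le_mul_of_nonneg_right h1 (by positivity)).trans h2
      have h4 : m * sechSq s * Real.exp (Z s)
          = 4 * m * Real.exp (2 * s) * (Real.exp (Z s) / w ^ 2) := by
        rw [sechSq]; ring
      rw [h4]
      have h5 : 0 < 4 * m * Real.exp (2 * s) := by positivity
      nlinarith) hl
  simp only [Pi.sub_apply] at this
  linarith

/-- Comparison with the bubble `a - 2 log (1 + κ e^{2t})`, `κ = m e^a / 2`. -/
lemma le_decay_bubble (hm : 2 < m) (h : IsRegularSol m a Z Y) (t : ℝ) :
    4 * (m * Real.exp a / 2 * Real.exp (2 * t)) / (1 + m * Real.exp a / 2 * Real.exp (2 * t))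
      ≤ decay m Y t := by
  have hpos := h.decay_pos (by linarith)
  have key : Real.exp (2 * t) * (4 / decay m Y t - 1) ≤ 2 / m * Real.exp (-a) := by
    have hl : Tendsto (fun s => 2 / m * Real.exp (-(Z s - m * Real.log (1 + Real.exp (2 * s)))))
        atBot (nhds (2 / m * Real.exp (-a))) :=
      ((Real.continuous_exp.tendsto (-a)).comp h.tendsto_sub_log.neg).const_mul (2 / m)
    refine ge_of_tendsto hl ?_
    filter_upwards [eventually_le_atBot t] with s hst
    have hanti := le_of_hasDerivAt_nonneg hst
      (fun r => ((hasDerivAt_exp_two_mul r).mul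
        (((hasDerivAt_const r (4 : ℝ)).div (h.hasDerivAt_decay r) (hpos r).ne').sub_const 1)).neg)
      fun r _ => by
        have h1 := h.decay_mul_le hm r
        have h2 := hpos r
        have h3 : -(2 * Real.exp (2 * r) * (4 / decay m Y r - 1) + Real.exp (2 * r) *
            ((0 * decay m Y r - 4 * (m * sechSq r * Real.exp (Z r))) / decay m Y r ^ 2))
            = Real.exp (2 * r) * 4 / decay m Y r ^ 2 * (m * sechSq r * Real.exp (Z r)
              - decay m Y r * (4 - decay m Y r) / 2) := by
          field_simp
          ring
        refine le_of_le_of_eq ?_ h3.symm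
        exact mul_nonneg (by positivity) (by linarith)
    simp only [Pi.neg_apply, Pi.mul_apply, Pi.div_apply, neg_le_neg_iff] at hanti
    refine hanti.trans ?_
    have h1 := h.le_decay hm s
    rw [Real.exp_neg]
    set c := Real.exp (Z s - m * Real.log (1 + Real.exp (2 * s))) with hc
    have hcpos : 0 < c := Real.exp_pos _
    have hx := Real.exp_pos (2 * s)
    have h2 : Real.exp (2 * s) * (4 / decay m Y s) ≤ 2 / m * c⁻¹ := by
      rw [← mul_div_assoc, div_le_iff₀ (hpos s)]
      calc Real.exp (2 * s) * 4 = 2 / m * c⁻¹ * (2 * m * c * Real.exp (2 * s)) := by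
            field_simp; ring
        _ ≤ 2 / m * c⁻¹ * decay m Y s := mul_le_mul_of_nonneg_left h1 (by positivity)
    linarith
  have hx := Real.exp_pos (2 * t)
  have hp := hpos t
  have ha := Real.exp_pos a
  rw [Real.exp_neg] at key
  rw [div_le_iff₀ (by positivity)]
  have h1 : Real.exp (2 * t) * (4 / decay m Y t - 1) * (decay m Y t * (m * Real.exp a / 2))
      ≤ 2 / m * (Real.exp a)⁻¹ * (decay m Y t * (m * Real.exp a / 2)) :=
    mul_le_mul_of_nonneg_right key (by positivity)
  have h2 : 2 / m * (Real.exp a)⁻¹ * (decay m Y t * (m * Real.exp a / 2)) = decay m Y t := by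
    field_simp
  have h3 : Real.exp (2 * t) * (4 / decay m Y t - 1) * (decay m Y t * (m * Real.exp a / 2))
      = Real.exp (2 * t) * (4 - decay m Y t) * (m * Real.exp a / 2) := by
    field_simp
  rw [h2, h3] at h1
  linarith

lemma Z_le_bubble (hm : 2 < m) (h : IsRegularSol m a Z Y) (t : ℝ) :
    Z t ≤ a - 2 * Real.log (1 + m * Real.exp a / 2 * Real.exp (2 * t))
      + m * Real.log (1 + Real.exp (2 * t)) := by
  set κ := m * Real.exp a / 2 with hκ
  have hκpos : 0 < κ := by positivity
  have hl : Tendsto ((fun s => Z s - m * Real.log (1 + Real.exp (2 * s))) +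
      fun s => 2 * Real.log (1 + κ * Real.exp (2 * s))) atBot (nhds a) := by
    have := h.tendsto_sub_log.add ((((tendsto_exp_two_mul_atBot.const_mul κ).const_add 1).log
      (by norm_num)).const_mul 2)
    rw [mul_zero, add_zero, Real.log_one, mul_zero, add_zero] at this
    exact this
  have := le_of_hasDerivAt_nonpos_of_tendsto_atBot
    (fun s => (h.hasDerivAt_sub_log s).add
      (((((hasDerivAt_exp_two_mul s).const_mul κ).const_add 1).log (by positivity)).const_mul 2)) t
    (fun s _ => by
      have := h.le_decay_bubble hm s
      have h2 : 2 * (κ * (2 * Real.exp (2 * s)) / (1 + κ * Real.exp (2 * s)))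
        = 4 * (κ * Real.exp (2 * s)) / (1 + κ * Real.exp (2 * s)) := by ring
      rw [h2]
      linarith) hl
  simp only [Pi.add_apply] at this
  linarith

/-- For large `a`, a solution has at most three zeros. -/
theorem not_hasZeros_four_of_ge (hm : 2 < m) (h : IsRegularSol m a Z Y)
    (ha : 2 * Real.log 2 + m * Real.log (1 + m) < a) : ¬ HasZeros Z 4 := by
  have hm0 : 0 < m := by linarith
  have hlog : 0 < m * Real.log (1 + m) := mul_pos hm0 (Real.log_pos (by linarith))
  have hlog2 : 0 < Real.log 2 := Real.log_pos one_lt_two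
  have hexp : 2 ≤ Real.exp a := by
    rw [← Real.log_le_iff_le_exp two_pos]
    linarith
  have hdecr : ∀ t, Real.exp (2 * t) < 1 / m → Y t < 0 := fun t ht => by
    have h1 := h.le_decay_bubble hm t
    set x := Real.exp (2 * t) with hx
    have hxpos : 0 < x := Real.exp_pos _
    set κ := m * Real.exp a / 2 with hκ
    have hκm : m ≤ κ := by rw [hκ]; nlinarith
    have h2 : Y t = 2 * m * (1 - 1 / (1 + x)) - decay m Y t := by unfold decay; ring
    have h3 : 2 * m * (1 - 1 / (1 + x)) < 4 * (κ * x) / (1 + κ * x) := by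
      have h4 : 2 * m * (1 - 1 / (1 + x)) = 2 * m * x / (1 + x) := by
        field_simp
        ring
      rw [lt_div_iff₀ hm0] at ht
      have hκpos : 0 < κ := by linarith
      rw [h4, div_lt_div_iff₀ (by positivity) (by positivity)]
      have h5 : (m - 2) * κ * x < 2 * κ - m := by nlinarith [mul_pos hκpos hxpos]
      nlinarith
    linarith
  have hneg : ∀ t, 1 / m ≤ Real.exp (2 * t) → Real.exp (2 * t) < m → Z t < 0 := fun t h1 h2 => by
    have h3 := h.Z_le_bubble hm t
    have h4 : Real.log (1 + Real.exp (2 * t)) ≤ Real.log (1 + m) :=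
      Real.log_le_log (by positivity) (by linarith)
    have h5 : a - Real.log 2 ≤ Real.log (1 + m * Real.exp a / 2 * Real.exp (2 * t)) := by
      have h6 : Real.log (Real.exp a / 2) = a - Real.log 2 := by
        rw [Real.log_div (Real.exp_pos a).ne' two_ne_zero, Real.log_exp]
      rw [← h6]
      refine Real.log_le_log (by positivity) ?_
      rw [div_le_iff₀ hm0] at h1
      nlinarith
    nlinarith
  refine h.not_hasZeros_four hm0 (by linarith) fun s t hst htm hs0 ht0 => ?_
  have htlt : Real.exp (2 * t) < 1 / m := by
    by_contra! hcon
    exact (hneg t hcon htm).ne ht0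
  have := lt_of_hasDerivAt_pos hst (fun r => (h.hasDerivAt_Z r).neg) fun r hr =>
    neg_pos.2 (hdecr r (lt_trans (Real.exp_lt_exp.2 (by linarith [hr.2])) htlt))
  simp [hs0, ht0] at this

end IsRegularSol

/-- `p'' + l sech² p = 0` with `p' = p₁`, bounded at both ends of the line. -/
structure IsComparator (l : ℝ) (p p₁ : ℝ → ℝ) : Prop where
  hasDerivAt_p : ∀ t, HasDerivAt p (p₁ t) t
  hasDerivAt_p₁ : ∀ t, HasDerivAt p₁ (-(sechSq t * (l * p t))) t
  tendsto_p : ∃ b, Tendsto p atBot (nhds b)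
  tendsto_p₁ : Tendsto p₁ atBot (nhds 0)
  tendsto_mul_p₁ : Tendsto (fun t => t * p₁ t) atTop (nhds 0)

/-- `Z'' + sech² R = 0` with `Z' = Y`, where `R` has the sign of `Z` and dominates `κ Z` up to
time `T`. -/
structure IsSturmMajorant (κ T : ℝ) (Z Y R : ℝ → ℝ) : Prop where
  hasDerivAt_Z : ∀ t, HasDerivAt Z (Y t) t
  hasDerivAt_Y : ∀ t, HasDerivAt Y (-(sechSq t * R t)) t
  mul_nonneg : ∀ t, 0 ≤ Z t * R t
  le_mul : ∀ t ≤ T, κ * Z t ^ 2 ≤ Z t * R t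
  tendsto_Z : ∃ a, a ≠ 0 ∧ Tendsto Z atBot (nhds a)
  tendsto_Y : Tendsto Y atBot (nhds 0)

lemma IsComparator.neg {l : ℝ} {p p₁ : ℝ → ℝ} (h : IsComparator l p p₁) :
    IsComparator l (-p) (-p₁) where
  hasDerivAt_p t := (h.hasDerivAt_p t).neg
  hasDerivAt_p₁ t := (h.hasDerivAt_p₁ t).neg.congr_deriv (by simp only [Pi.neg_apply]; ring)
  tendsto_p := by
    obtain ⟨b, hb⟩ := h.tendsto_p
    exact ⟨-b, hb.neg⟩
  tendsto_p₁ := by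
    have := h.tendsto_p₁.neg
    rwa [neg_zero] at this
  tendsto_mul_p₁ := by
    have := h.tendsto_mul_p₁.neg
    rw [neg_zero] at this
    exact this.congr fun t => by simp only [Pi.neg_apply]; ring

lemma IsComparator.continuous_p {l : ℝ} {p p₁ : ℝ → ℝ} (h : IsComparator l p p₁) :
    Continuous p := continuous_iff_continuousAt.2 fun t => (h.hasDerivAt_p t).continuousAt

lemma pos_or_neg_of_ne_zero {f : ℝ → ℝ} {s : Set ℝ} (hs : IsPreconnected s) (hf : Continuous f)
    (h : ∀ t ∈ s, f t ≠ 0) : (∀ t ∈ s, 0 < f t) ∨ (∀ t ∈ s, f t < 0) := by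
  by_contra! hcon
  obtain ⟨⟨x, hx, hx0⟩, y, hy, hy0⟩ := hcon
  obtain ⟨r, hr, hr0⟩ := hs.intermediate_value hx hy hf.continuousOn ⟨hx0, hy0⟩
  exact h r hr hr0

namespace IsSturmMajorant

variable {κ T l : ℝ} {Z Y R p p₁ : ℝ → ℝ}

lemma continuous_Z (h : IsSturmMajorant κ T Z Y R) : Continuous Z :=
  continuous_iff_continuousAt.2 fun t => (h.hasDerivAt_Z t).continuousAt

lemma neg (h : IsSturmMajorant κ T Z Y R) : IsSturmMajorant κ T (-Z) (-Y) (-R) where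
  hasDerivAt_Z t := (h.hasDerivAt_Z t).neg
  hasDerivAt_Y t := (h.hasDerivAt_Y t).neg.congr_deriv (by simp only [Pi.neg_apply]; ring)
  mul_nonneg t := by simpa using h.mul_nonneg t
  le_mul t ht := by simpa using h.le_mul t ht
  tendsto_Z := by
    obtain ⟨a, ha, hZ⟩ := h.tendsto_Z
    exact ⟨-a, neg_ne_zero.2 ha, hZ.neg⟩
  tendsto_Y := by
    have := h.tendsto_Y.neg
    rwa [neg_zero] at this

/-- The derivative of the Wronskian. -/
lemma hasDerivAt_wronskian (h : IsSturmMajorant κ T Z Y R) (hp : IsComparator l p p₁) (t : ℝ) :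
    HasDerivAt (fun t => Z t * p₁ t - Y t * p t) (sechSq t * (p t * (R t - l * Z t))) t :=
  (((h.hasDerivAt_Z t).mul (hp.hasDerivAt_p₁ t)).sub
    ((h.hasDerivAt_Y t).mul (hp.hasDerivAt_p t))).congr_deriv (by ring)

lemma le_mul_sub (h : IsSturmMajorant κ T Z Y R) {t : ℝ} (ht : t ≤ T)
    (hpos : 0 < Z t * p t) : (κ - l) * (Z t * p t) ≤ p t * (R t - l * Z t) := by
  have hZ : Z t ≠ 0 := left_ne_zero_of_mul hpos.ne'
  have hZ2 : 0 < Z t ^ 2 := by positivity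
  have h1 := h.le_mul t ht
  have h2 : (κ - l) * (Z t * p t) * Z t ^ 2 ≤ p t * (R t - l * Z t) * Z t ^ 2 := by
    have := mul_le_mul_of_nonneg_right h1 hpos.le
    nlinarith
  exact le_of_mul_le_mul_right h2 hZ2

lemma wronskian_deriv_pos (h : IsSturmMajorant κ T Z Y R) (hl : l < κ) {t : ℝ}
    (ht : t ≤ T) (hpos : 0 < Z t * p t) : 0 < sechSq t * (p t * (R t - l * Z t)) :=
  mul_pos (sechSq_pos t) (lt_of_lt_of_le (mul_pos (sub_pos.2 hl) hpos) (h.le_mul_sub ht hpos))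

lemma wronskian_right_nonpos (h : IsSturmMajorant κ T Z Y R) (hp : IsComparator l p p₁) {s t : ℝ}
    (hst : s < t) (ht0 : p t = 0) (hpos : ∀ r ∈ Ioo s t, 0 < Z r * p r) :
    Z t * p₁ t - Y t * p t ≤ 0 := by
  have := deriv_nonpos_of_pos_left ((h.hasDerivAt_Z t).mul (hp.hasDerivAt_p t))
    (by simp [ht0]) hst hpos
  rw [ht0] at this ⊢
  linarith

lemma wronskian_left_nonneg (h : IsSturmMajorant κ T Z Y R) (hp : IsComparator l p p₁) {s t : ℝ}
    (hst : s < t) (hs0 : p s = 0) (hpos : ∀ r ∈ Ioo s t, 0 < Z r * p r) :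
    0 ≤ Z s * p₁ s - Y s * p s := by
  have := deriv_nonneg_of_pos_right ((h.hasDerivAt_Z s).mul (hp.hasDerivAt_p s))
    (by simp [hs0]) hst hpos
  rw [hs0] at this ⊢
  linarith

lemma false_of_Ioo_pos (h : IsSturmMajorant κ T Z Y R) (hp : IsComparator l p p₁) (hl : l < κ)
    {s t : ℝ} (hst : s < t) (htT : t ≤ T) (hs0 : p s = 0) (ht0 : p t = 0)
    (hpos : ∀ r ∈ Ioo s t, 0 < Z r * p r) : False := by
  have h1 := h.wronskian_left_nonneg hp hst hs0 hpos
  have h2 := h.wronskian_right_nonpos hp hst ht0 hpos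
  have h3 := lt_of_hasDerivAt_pos hst (h.hasDerivAt_wronskian hp) fun r hr =>
    h.wronskian_deriv_pos hl (hr.2.le.trans htT) (hpos r hr)
  linarith

lemma false_of_Iio_pos (h : IsSturmMajorant κ T Z Y R) (hp : IsComparator l p p₁) (hl : l < κ)
    {t : ℝ} (htT : t ≤ T) (ht0 : p t = 0) (hpos : ∀ r < t, 0 < Z r * p r) : False := by
  have h2 := h.wronskian_right_nonpos hp (sub_one_lt t) ht0 fun r hr => hpos r hr.2
  have h3 := lt_of_hasDerivAt_pos (sub_one_lt t) (h.hasDerivAt_wronskian hp) fun r hr =>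
    h.wronskian_deriv_pos hl (hr.2.le.trans htT) (hpos r hr.2)
  obtain ⟨a, -, hZ⟩ := h.tendsto_Z
  obtain ⟨b, hb⟩ := hp.tendsto_p
  have hlim : Tendsto (-fun t => Z t * p₁ t - Y t * p t) atBot (nhds (-(a * 0 - 0 * b))) :=
    ((hZ.mul hp.tendsto_p₁).sub (h.tendsto_Y.mul hb)).neg
  have h4 := le_of_hasDerivAt_nonpos_of_tendsto_atBot
    (fun r => (h.hasDerivAt_wronskian hp r).neg) (t - 1) (fun r hr =>
      neg_nonpos.2 (h.wronskian_deriv_pos hl (by linarith) (hpos r (by linarith))).le) hlim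
  simp only [Pi.neg_apply] at h4
  linarith

lemma false_of_Ioi_pos_of_pos (h : IsSturmMajorant κ T Z Y R) (hp : IsComparator l p p₁)
    (hl : l < κ) {s c : ℝ} (hsT : s + 2 ≤ T) (hs0 : p s = 0) (hZ : ∀ r > s, 0 < Z r)
    (hp0 : ∀ r > s, 0 < p r) (hc : ∀ r ∈ Icc (s + 1) (s + 2), c ≤ sechSq r * |p r|)
    (hT : (T - s) * |p₁ T| < (κ - l) * c) : False := by
  have hpos : ∀ r > s, 0 < Z r * p r := fun r hr => mul_pos (hZ r hr) (hp0 r hr)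
  have hanti : ∀ r t, s < r → r ≤ t → Y t ≤ Y r := fun r t hr hrt => by
    have := le_of_hasDerivAt_nonneg hrt (fun x => (h.hasDerivAt_Y x).neg) fun x hx => by
      rw [neg_neg]
      exact _root_.mul_nonneg (sechSq_pos x).le
        ((mul_nonneg_iff_of_pos_left (hZ x (hr.trans hx.1))).1 (h.mul_nonneg x))
    simp only [Pi.neg_apply] at this
    linarith
  have hline : ∀ r t, s < r → r ≤ t → Z t ≤ Z r + Y r * (t - r) := fun r t hr hrt => by
    have := le_of_hasDerivAt_nonneg hrt
      (fun x => ((hasDerivAt_id x).const_mul (Y r)).sub (h.hasDerivAt_Z x)) fun x hx => by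
        have := hanti r x hr hx.1.le
        linarith
    simp only [Pi.sub_apply, id] at this
    linarith
  have hnn : ∀ t > s, 0 ≤ Y t := by
    intro t ht
    by_contra! hcon
    have hz' : 0 < Z t / -Y t := div_pos (hZ t ht) (by linarith)
    have h1 := hline t (t + Z t / -Y t) ht (by linarith)
    have h2 := hZ (t + Z t / -Y t) (by linarith)
    have h3 : Y t * (t + Z t / -Y t - t) = -Z t := by
      have : Y t ≠ 0 := hcon.ne
      field_simp
      ring
    linarith
  have hmono : ∀ r t, s ≤ r → r ≤ t → Z r ≤ Z t := fun r t hr hrt =>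
    le_of_hasDerivAt_nonneg hrt h.hasDerivAt_Z fun x hx => hnn x (hr.trans_lt hx.1)
  have hZs : 0 ≤ Z s := ge_of_tendsto (h.continuous_Z.continuousWithinAt (s := Ioi s))
    (eventually_nhdsWithin_of_forall fun r hr => (hZ r hr).le)
  set z := Z (s + 1) with hz
  have hzpos : 0 < z := hZ _ (by linarith)
  have hYz : Y (s + 1) ≤ z := by
    have := le_of_hasDerivAt_nonneg (by linarith : s ≤ s + 1)
      (fun x => (h.hasDerivAt_Z x).sub ((hasDerivAt_id x).const_mul (Y (s + 1)))) fun x hx => by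
        have := hanti x (s + 1) hx.1 hx.2.le
        linarith
    simp only [Pi.sub_apply, id] at this
    linarith
  have hZT : Z T ≤ z * (T - s) := by
    have h1 := hline (s + 1) T (by linarith) (by linarith)
    have h2 := mul_le_mul_of_nonneg_right hYz (by linarith : 0 ≤ T - (s + 1))
    linarith
  have hW := h.hasDerivAt_wronskian hp
  have hW0 := h.wronskian_left_nonneg hp (lt_add_one s) hs0 fun r hr => hpos r hr.1
  have hW1 := le_of_hasDerivAt_nonneg (by linarith : s ≤ s + 1) hW fun r hr =>
    (h.wronskian_deriv_pos hl (by linarith [hr.2]) (hpos r hr.1)).le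
  have hW2 := le_of_hasDerivAt_nonneg (by linarith : s + 1 ≤ s + 2)
    (fun r => (hW r).sub ((hasDerivAt_id r).const_mul ((κ - l) * c * z))) fun r hr => by
      have h1 := h.le_mul_sub (l := l) (by linarith [hr.2]) (hpos r (by linarith [hr.1]))
      have h2 := hc r ⟨hr.1.le, hr.2.le⟩
      have hpr := hp0 r (by linarith [hr.1])
      rw [abs_of_pos hpr] at h2
      have h3 := hmono (s + 1) r (by linarith) hr.1.le
      have h4 := mul_le_mul_of_nonneg_left h1 (sechSq_pos r).le
      have h5 : c * z ≤ sechSq r * p r * Z r :=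
        (mul_le_mul_of_nonneg_right h2 hzpos.le).trans
          (mul_le_mul_of_nonneg_left h3 (mul_pos (sechSq_pos r) hpr).le)
      have h6 := mul_le_mul_of_nonneg_left h5 (sub_pos.2 hl).le
      linarith
  have hW3 := le_of_hasDerivAt_nonneg hsT hW fun r hr =>
    (h.wronskian_deriv_pos hl hr.2.le (hpos r (by linarith [hr.1]))).le
  simp only [Pi.sub_apply, id] at hW2
  have hYp : 0 ≤ Y T * p T :=
    _root_.mul_nonneg (hnn T (by linarith)) (hp0 T (by linarith)).le
  have h7 : Z T * p₁ T ≤ z * (T - s) * |p₁ T| :=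
    (mul_le_mul_of_nonneg_left (le_abs_self _) (hZ T (by linarith)).le).trans
      (mul_le_mul_of_nonneg_right hZT (abs_nonneg _))
  have h8 := mul_lt_mul_of_pos_left hT hzpos
  linarith

lemma false_of_Ioi_pos (h : IsSturmMajorant κ T Z Y R) (hp : IsComparator l p p₁)
    (hl : l < κ) {s c : ℝ} (hsT : s + 2 ≤ T) (hs0 : p s = 0) (hpos : ∀ r > s, 0 < Z r * p r)
    (hc : ∀ r ∈ Icc (s + 1) (s + 2), c ≤ sechSq r * |p r|)
    (hT : (T - s) * |p₁ T| < (κ - l) * c) : False := by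
  rcases pos_or_neg_of_ne_zero (isPreconnected_Ioi (a := s)) h.continuous_Z
    fun r hr => left_ne_zero_of_mul (hpos r hr).ne' with hZ | hZ
  · exact h.false_of_Ioi_pos_of_pos hp hl hsT hs0 hZ
      (fun r hr => (mul_pos_iff_of_pos_left (hZ r hr)).1 (hpos r hr)) hc hT
  · refine h.neg.false_of_Ioi_pos_of_pos hp.neg hl hsT (by simp [hs0])
      (fun r hr => neg_pos.2 (hZ r hr)) (fun r hr => ?_) (c := c) (by simpa using hc)
      (by simpa using hT)
    have h1 := hZ r hr
    have h2 := hpos r hr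
    simp only [Pi.neg_apply]
    by_contra! hcon
    nlinarith

end IsSturmMajorant

/-- Sturm comparison on the whole line: a majorant has one more zero than the comparator. -/
theorem exists_forall_hasZeros_of_comparator {l κ : ℝ} {p p₁ : ℝ → ℝ} (hp : IsComparator l p p₁)
    (hl : l < κ) {n : ℕ} {τ : Fin (n + 1) → ℝ} (hτ : StrictMono τ) (hτ0 : ∀ i, p (τ i) = 0)
    (hτu : ∀ t, p t = 0 → ∃ i, t = τ i) :
    ∃ T, ∀ Z Y R : ℝ → ℝ, IsSturmMajorant κ T Z Y R → HasZeros Z (n + 2) := by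
  set s := τ (Fin.last n) with hs
  have hlast : ∀ i, τ i ≤ s := fun i => hτ.monotone (Fin.le_last i)
  have hpne : ∀ t > s, p t ≠ 0 := fun t ht h0 => by
    obtain ⟨i, rfl⟩ := hτu t h0
    exact absurd (hlast i) (not_le.2 ht)
  obtain ⟨c, hc0, hc⟩ : ∃ c > 0, ∀ r ∈ Icc (s + 1) (s + 2), c ≤ sechSq r * |p r| := by
    obtain ⟨x, hx, hmin⟩ := isCompact_Icc.exists_isMinOn (s := Icc (s + 1) (s + 2))
      (nonempty_Icc.2 (by linarith))
      (continuous_sechSq.mul hp.continuous_p.abs).continuousOn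
    exact ⟨_, mul_pos (sechSq_pos x) (abs_pos.2 (hpne x (by linarith [hx.1]))),
      fun r hr => hmin hr⟩
  have hlim : Tendsto (fun t => (t - s) * |p₁ t|) atTop (nhds 0) := by
    have h1 : Tendsto (fun t => 2 * |t * p₁ t|) atTop (nhds 0) := by
      simpa using (hp.tendsto_mul_p₁.abs).const_mul 2
    refine squeeze_zero' ?_ ?_ h1
    · filter_upwards [eventually_ge_atTop s] with t ht
      exact mul_nonneg (by linarith) (abs_nonneg _)
    · filter_upwards [eventually_ge_atTop |s|] with t ht
      have h2 : 0 ≤ t := (abs_nonneg s).trans ht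
      rw [abs_mul, abs_of_nonneg h2]
      have h3 := abs_nonneg (p₁ t)
      have h4 := neg_abs_le s
      nlinarith
  obtain ⟨T, hT, hsT⟩ := ((hlim.eventually (gt_mem_nhds (mul_pos (sub_pos.2 hl) hc0))).and
    (eventually_ge_atTop (s + 2))).exists
  refine ⟨T, fun Z Y R h => ?_⟩
  have hsign : ∀ S : Set ℝ, IsPreconnected S → (∀ t ∈ S, p t ≠ 0) →
      (∀ p p₁ : ℝ → ℝ, IsComparator l p p₁ → (∀ i, p (τ i) = 0) →
        (∀ r ∈ Icc (s + 1) (s + 2), c ≤ sechSq r * |p r|) →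
        (T - s) * |p₁ T| < (κ - l) * c → (∀ r ∈ S, 0 < Z r * p r) → False) →
      ∃ t ∈ S, Z t = 0 := by
    intro S hS hpS hfalse
    by_contra! hcon
    rcases pos_or_neg_of_ne_zero hS (h.continuous_Z.mul hp.continuous_p)
      (fun t ht => mul_ne_zero (hcon t ht) (hpS t ht)) with hpos | hneg
    · exact hfalse p p₁ hp hτ0 hc hT hpos
    · exact hfalse (-p) (-p₁) hp.neg (by simpa using hτ0) (by simpa using hc) (by simpa using hT)
        (fun r hr => by simpa using hneg r hr)
  have hz : ∀ i : Fin (n + 2), ∃ z, Z z = 0 ∧ (∀ j : Fin (n + 1), i = j.succ → τ j < z) ∧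
      (∀ j : Fin (n + 1), i = j.castSucc → z < τ j) := by
    intro i
    induction i using Fin.cases with
    | zero =>
      obtain ⟨z, hz, hz0⟩ := hsign (Iio (τ 0)) isPreconnected_Iio
        (fun t ht h0 => by
          obtain ⟨i, rfl⟩ := hτu t h0
          exact absurd (hτ.monotone (Fin.zero_le i)) (not_le.2 ht))
        (fun p p₁ hp hp0 _ _ hpos =>
          h.false_of_Iio_pos hp hl (by linarith [hlast 0]) (hp0 0) hpos)
      refine ⟨z, hz0, fun j hj => absurd hj (Fin.succ_ne_zero j).symm, fun j hj => ?_⟩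
      have : j = 0 := Fin.castSucc_injective _ (by rw [← hj]; rfl)
      rw [this]; exact hz
    | succ i =>
      induction i using Fin.lastCases with
      | last =>
        obtain ⟨z, hz, hz0⟩ := hsign (Ioi s) isPreconnected_Ioi hpne
          (fun p p₁ hp hp0 hc hT hpos => h.false_of_Ioi_pos hp hl hsT (hp0 _) hpos hc hT)
        refine ⟨z, hz0, fun j hj => ?_, fun j hj => ?_⟩
        · rw [← Fin.succ_injective _ hj]; exact hz
        · have := j.isLt
          have := congrArg Fin.val hj
          simp at this
          omega
      | cast i =>
        have hlt : τ i.castSucc < τ i.succ := hτ Fin.castSucc_lt_succ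
        obtain ⟨z, hz, hz0⟩ := hsign (Ioo (τ i.castSucc) (τ i.succ)) isPreconnected_Ioo
          (fun t ht h0 => by
            obtain ⟨j, rfl⟩ := hτu t h0
            have h1 := Fin.lt_def.1 (hτ.lt_iff_lt.1 ht.1)
            have h2 := Fin.lt_def.1 (hτ.lt_iff_lt.1 ht.2)
            simp at h1 h2
            omega)
          (fun p p₁ hp hp0 _ _ hpos => h.false_of_Ioo_pos hp hl hlt
            (by linarith [hlast i.succ]) (hp0 _) (hp0 _) hpos)
        refine ⟨z, hz0, fun j hj => ?_, fun j hj => ?_⟩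
        · rw [← Fin.succ_injective _ hj]; exact hz.1
        · rw [Fin.succ_castSucc] at hj
          rw [← Fin.castSucc_injective _ hj]; exact hz.2
  choose z hz0 hz1 hz2 using hz
  exact ⟨z, Fin.strictMono_iff_lt_succ.2 fun i => (hz2 _ i rfl).trans (hz1 _ i rfl), hz0⟩

/-- The hyperbolic tangent, as the primitive of `sechSq`. -/
def tanhAux (t : ℝ) : ℝ := 1 - 2 / (1 + Real.exp (2 * t))

lemma hasDerivAt_tanhAux (t : ℝ) : HasDerivAt tanhAux (sechSq t) t := by
  have h0 : (1 : ℝ) + Real.exp (2 * t) ≠ 0 := by positivity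
  have h := ((hasDerivAt_const t (2 : ℝ)).div ((hasDerivAt_exp_two_mul t).const_add 1) h0).const_sub 1
  refine h.congr_deriv ?_
  unfold sechSq
  ring

lemma one_sub_tanhAux_sq (t : ℝ) : 1 - tanhAux t ^ 2 = sechSq t := by
  have h0 : (1 : ℝ) + Real.exp (2 * t) ≠ 0 := by positivity
  unfold tanhAux sechSq
  field_simp
  ring

lemma tanhAux_injective : Function.Injective tanhAux :=
  (strictMono_of_deriv_pos fun t => by
    rw [(hasDerivAt_tanhAux t).deriv]; exact sechSq_pos t).injective

lemma tendsto_tanhAux_atBot : Tendsto tanhAux atBot (nhds (-1)) := by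
  have h := ((tendsto_const_nhds (x := (2 : ℝ))).div (tendsto_exp_two_mul_atBot.const_add 1)
    (by norm_num)).const_sub (1 : ℝ)
  norm_num at h
  exact h

lemma tendsto_tanhAux_atTop : Tendsto tanhAux atTop (nhds 1) := by
  have h := ((tendsto_atTop_add_const_left atTop (1 : ℝ) tendsto_exp_two_mul_atTop).const_div_atTop
    (2 : ℝ)).const_sub (1 : ℝ)
  rwa [sub_zero] at h

lemma tendsto_mul_sechSq_atTop : Tendsto (fun t => t * sechSq t) atTop (nhds 0) := by
  have h1 : Tendsto (fun t : ℝ => 2 * ((2 * t) ^ 1 * Real.exp (-(2 * t)))) atTop (nhds 0) := by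
    have h := ((Real.tendsto_pow_mul_exp_neg_atTop_nhds_zero 1).comp
      (tendsto_id.const_mul_atTop (two_pos : (0 : ℝ) < 2))).const_mul 2
    rw [mul_zero] at h
    exact h
  refine squeeze_zero' ?_ ?_ h1
  · filter_upwards [eventually_ge_atTop 0] with t ht
    exact mul_nonneg ht (sechSq_pos t).le
  · filter_upwards [eventually_ge_atTop 0] with t ht
    have := mul_le_mul_of_nonneg_left (sechSq_le_exp_neg t) ht
    linarith

/-- The Legendre polynomial of degree `n + 1`. -/
def legendrePoly : ℕ → Polynomial ℝ
  | 0 => Polynomial.X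
  | n + 1 => Polynomial.X * legendrePoly n - Polynomial.C (1 / ((n : ℝ) + 2)) *
      ((1 - Polynomial.X ^ 2) * Polynomial.derivative (legendrePoly n))

lemma natDegree_legendrePoly_le (n : ℕ) : (legendrePoly n).natDegree ≤ n + 1 := by
  induction n with
  | zero => exact Polynomial.natDegree_X_le
  | succ n ih =>
    have hd := Polynomial.natDegree_derivative_le (legendrePoly n)
    have h2 : (1 - Polynomial.X ^ 2 : Polynomial ℝ).natDegree ≤ 2 := by compute_degree
    rw [legendrePoly]
    refine (Polynomial.natDegree_sub_le _ _).trans (max_le ?_ ?_)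
    · refine Polynomial.natDegree_mul_le.trans ?_
      have := Polynomial.natDegree_X_le (R := ℝ)
      omega
    · refine (Polynomial.natDegree_C_mul_le _ _).trans (Polynomial.natDegree_mul_le.trans ?_)
      omega

lemma eval_neg_one_legendrePoly (n : ℕ) : (legendrePoly n).eval (-1) = (-1) ^ (n + 1) := by
  induction n with
  | zero => simp [legendrePoly]
  | succ n ih => simp [legendrePoly, ih, pow_succ]

lemma eval_neg_one_legendrePoly_ne_zero (n : ℕ) : (legendrePoly n).eval (-1) ≠ 0 := by
  rw [eval_neg_one_legendrePoly]
  exact pow_ne_zero _ (by norm_num)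

lemma legendrePoly_ode (n : ℕ) (y : ℝ) :
    (1 - y ^ 2) * (Polynomial.derivative (Polynomial.derivative (legendrePoly n))).eval y
      - 2 * y * (Polynomial.derivative (legendrePoly n)).eval y
      + ((n : ℝ) + 1) * (n + 2) * (legendrePoly n).eval y = 0 := by
  have hpoly : ∀ n : ℕ, (1 - Polynomial.X ^ 2) *
        Polynomial.derivative (Polynomial.derivative (legendrePoly n))
      - 2 * Polynomial.X * Polynomial.derivative (legendrePoly n)
      + Polynomial.C (((n : ℝ) + 1) * (n + 2)) * legendrePoly n = 0 := by
    intro n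
    induction n with
    | zero =>
      have h2 : Polynomial.C (2 : ℝ) = 2 := rfl
      simp [legendrePoly, h2]
    | succ n ih =>
      have hc : Polynomial.C (1 / ((n : ℝ) + 2)) * Polynomial.C ((n : ℝ) + 2) = 1 := by
        rw [← Polynomial.C_mul, one_div, inv_mul_cancel₀ (by positivity), Polynomial.C_1]
      rw [Polynomial.C_mul] at ih
      have h1 : Polynomial.derivative (legendrePoly (n + 1)) =
          Polynomial.C ((n : ℝ) + 2) * legendrePoly n
            + Polynomial.X * Polynomial.derivative (legendrePoly n) := by
        rw [legendrePoly]
        simp only [Polynomial.derivative_sub, Polynomial.derivative_mul, Polynomial.derivative_X,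
          Polynomial.derivative_C, Polynomial.derivative_one, Polynomial.derivative_X_sq]
        have h2 : Polynomial.C ((n : ℝ) + 2) = Polynomial.C ((n : ℝ) + 1) + 1 := by
          rw [← Polynomial.C_1, ← Polynomial.C_add]; congr 1; ring
        have h3 : (Polynomial.C (2 : ℝ)) = 2 := rfl
        rw [h3]
        linear_combination (-Polynomial.C (1 / ((n : ℝ) + 2))) * ih
          + Polynomial.C ((n : ℝ) + 1) * legendrePoly n * hc - legendrePoly n * h2
      have h4 : Polynomial.derivative (Polynomial.derivative (legendrePoly (n + 1))) =
          (Polynomial.C ((n : ℝ) + 2) + 1) * Polynomial.derivative (legendrePoly n)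
            + Polynomial.X * Polynomial.derivative (Polynomial.derivative (legendrePoly n)) := by
        rw [h1]
        simp only [Polynomial.derivative_add, Polynomial.derivative_mul, Polynomial.derivative_X,
          Polynomial.derivative_C]
        ring
      have h5 : Polynomial.C ((((n + 1 : ℕ) : ℝ) + 1) * (((n + 1 : ℕ) : ℝ) + 2)) =
          Polynomial.C ((n : ℝ) + 2) * (Polynomial.C ((n : ℝ) + 2) + 1) := by
        rw [← Polynomial.C_1, ← Polynomial.C_add, ← Polynomial.C_mul]
        congr 1; push_cast; ring
      have h6 : Polynomial.C ((n : ℝ) + 1) = Polynomial.C ((n : ℝ) + 2) - 1 := by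
        rw [← Polynomial.C_1, ← Polynomial.C_sub]; congr 1; ring
      rw [h4, h1, h5, legendrePoly]
      rw [h6] at ih
      linear_combination Polynomial.X * ih - (Polynomial.C ((n : ℝ) + 2) + 1) *
        ((1 - Polynomial.X ^ 2) * Polynomial.derivative (legendrePoly n)) * hc
  simpa using congrArg (Polynomial.eval y) (hpoly n)

/-- A Legendre polynomial in logarithmic coordinates. -/
def legendreFun (n : ℕ) (t : ℝ) : ℝ := (legendrePoly n).eval (tanhAux t)

/-- The derivative of `legendreFun`. -/
def legendreSlope (n : ℕ) (t : ℝ) : ℝ :=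
  sechSq t * (Polynomial.derivative (legendrePoly n)).eval (tanhAux t)

lemma tendsto_legendreFun_atBot (n : ℕ) :
    Tendsto (legendreFun n) atBot (nhds ((legendrePoly n).eval (-1))) :=
  ((legendrePoly n).continuous.tendsto _).comp tendsto_tanhAux_atBot

lemma isComparator_legendre (n : ℕ) :
    IsComparator (((n : ℝ) + 1) * (n + 2)) (legendreFun n) (legendreSlope n) where
  hasDerivAt_p t :=
    (((legendrePoly n).hasDerivAt (tanhAux t)).comp t (hasDerivAt_tanhAux t)).congr_deriv
      (mul_comm _ _)
  hasDerivAt_p₁ t := by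
    have h := (hasDerivAt_sechSq t).mul
      (((Polynomial.derivative (legendrePoly n)).hasDerivAt (tanhAux t)).comp t
        (hasDerivAt_tanhAux t))
    refine h.congr_deriv ?_
    have hode := legendrePoly_ode n (tanhAux t)
    rw [one_sub_tanhAux_sq] at hode
    have hy : 2 - 4 * (1 - 1 / (1 + Real.exp (2 * t))) = -(2 * tanhAux t) := by
      unfold tanhAux; ring
    rw [hy]
    unfold legendreFun
    simp only [Function.comp_apply]
    linear_combination sechSq t * hode
  tendsto_p := ⟨_, tendsto_legendreFun_atBot n⟩
  tendsto_p₁ := by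
    have h := tendsto_sechSq_atBot.mul
      (((Polynomial.derivative (legendrePoly n)).continuous.tendsto _).comp tendsto_tanhAux_atBot)
    rw [zero_mul] at h
    exact h
  tendsto_mul_p₁ := by
    have h := tendsto_mul_sechSq_atTop.mul
      (((Polynomial.derivative (legendrePoly n)).continuous.tendsto _).comp tendsto_tanhAux_atTop)
    rw [zero_mul] at h
    exact h.congr fun t => mul_assoc _ _ _

lemma exists_eq_of_legendreFun_eq_zero {n : ℕ} {τ : Fin (n + 1) → ℝ} (hτ : StrictMono τ)
    (hτ0 : ∀ i, legendreFun n (τ i) = 0) {t : ℝ} (ht : legendreFun n t = 0) : ∃ i, t = τ i := by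
  by_contra! hcon
  have hne : legendrePoly n ≠ 0 := by
    intro h
    exact eval_neg_one_legendrePoly_ne_zero n (by rw [h, Polynomial.eval_zero])
  have hinj : Function.Injective (Fin.cons t τ : Fin (n + 2) → ℝ) :=
    Fin.cons_injective_iff.2 ⟨fun ⟨i, hi⟩ => hcon i hi.symm, hτ.injective⟩
  have hsub : Finset.univ.image (tanhAux ∘ (Fin.cons t τ : Fin (n + 2) → ℝ)) ⊆
      (legendrePoly n).roots.toFinset := by
    intro x hx
    obtain ⟨i, -, rfl⟩ := Finset.mem_image.1 hx
    rw [Multiset.mem_toFinset, Polynomial.mem_roots hne]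
    refine Fin.cases ?_ (fun i => ?_) i
    · exact ht
    · exact hτ0 i
  have hcard := Finset.card_le_card hsub
  rw [Finset.card_image_of_injective _ (tanhAux_injective.comp hinj), Finset.card_univ,
    Fintype.card_fin] at hcard
  have := (Multiset.toFinset_card_le _).trans (Polynomial.card_roots' (legendrePoly n))
  have := natDegree_legendrePoly_le n
  omega

lemma hasZeros_legendreFun (n : ℕ) : HasZeros (legendreFun n) (n + 1) := by
  induction n with
  | zero =>
    refine ⟨fun _ => 0, fun i j hij => absurd hij (by omega), fun _ => ?_⟩
    norm_num [legendreFun, legendrePoly, tanhAux]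
  | succ n ih =>
    obtain ⟨τ, hτ, hτ0⟩ := ih
    have hl : ((n : ℝ) + 1) * (n + 2) < (((n + 1 : ℕ) : ℝ) + 1) * ((n + 1 : ℕ) + 2) := by
      push_cast
      nlinarith [(Nat.cast_nonneg n : (0 : ℝ) ≤ n)]
    obtain ⟨T, hT⟩ := exists_forall_hasZeros_of_comparator (isComparator_legendre n) hl hτ hτ0
      fun t => exists_eq_of_legendreFun_eq_zero hτ hτ0
    refine hT (legendreFun (n + 1)) (legendreSlope (n + 1)) (fun t =>
      (((n + 1 : ℕ) : ℝ) + 1) * ((n + 1 : ℕ) + 2) * legendreFun (n + 1) t) ?_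
    have hC := isComparator_legendre (n + 1)
    have hp : (0 : ℝ) ≤ (((n + 1 : ℕ) : ℝ) + 1) * ((n + 1 : ℕ) + 2) := by positivity
    exact
      { hasDerivAt_Z := hC.hasDerivAt_p
        hasDerivAt_Y := hC.hasDerivAt_p₁
        mul_nonneg := fun t => by
          have := mul_nonneg hp (sq_nonneg (legendreFun (n + 1) t))
          linarith
        le_mul := fun t _ => le_of_eq (by ring)
        tendsto_Z := ⟨_, eval_neg_one_legendrePoly_ne_zero _, tendsto_legendreFun_atBot _⟩
        tendsto_Y := hC.tendsto_p₁ }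

/-- Every `Z'' + sech² R = 0` with `R` above the critical slope `(n + 1) (n + 2)` up to a large
time has at least `n + 2` zeros. -/
theorem exists_forall_hasZeros {n : ℕ} {κ : ℝ} (hκ : ((n : ℝ) + 1) * (n + 2) < κ) :
    ∃ T, ∀ Z Y R, IsSturmMajorant κ T Z Y R → HasZeros Z (n + 2) := by
  obtain ⟨τ, hτ, hτ0⟩ := hasZeros_legendreFun n
  exact exists_forall_hasZeros_of_comparator (isComparator_legendre n) hκ hτ hτ0
    fun t => exists_eq_of_legendreFun_eq_zero hτ hτ0

lemma sq_le_mul_exp_sub_one {ζ ε : ℝ} (h : |ζ| ≤ ε) :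
    ζ ^ 2 ≤ (1 + ε) * (ζ * (Real.exp ζ - 1)) := by
  have hε : 0 ≤ ε := (abs_nonneg ζ).trans h
  rcases le_total 0 ζ with hζ | hζ
  · have h1 := Real.add_one_le_exp ζ
    have h2 : ζ * ζ ≤ ζ * (Real.exp ζ - 1) := mul_le_mul_of_nonneg_left (by linarith) hζ
    have h3 : 0 ≤ ε * (ζ * (Real.exp ζ - 1)) := by
      refine mul_nonneg hε (le_trans ?_ h2); exact mul_self_nonneg ζ
    nlinarith
  · rw [abs_of_nonpos hζ] at h
    have h1 := Real.add_one_le_exp (-ζ)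
    have h2 : Real.exp (-ζ) * Real.exp ζ = 1 := by rw [← Real.exp_add]; simp
    have h3 : (1 - ζ) * Real.exp ζ ≤ 1 := by
      rw [← h2]
      exact mul_le_mul_of_nonneg_right (by linarith) (Real.exp_pos _).le
    have h4 : Real.exp ζ ≤ 1 := Real.exp_le_one_iff.2 hζ
    have h5 : -ζ ≤ (1 + ε) * (1 - Real.exp ζ) := by nlinarith
    nlinarith

lemma mul_exp_sub_one_nonneg (ζ : ℝ) : 0 ≤ ζ * (Real.exp ζ - 1) := by
  rcases le_total 0 ζ with h | h
  · exact mul_nonneg h (by linarith [Real.one_le_exp h])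
  · exact mul_nonneg_of_nonpos_of_nonpos h (by linarith [Real.exp_le_one_iff.2 h])

/-- Close to the trivial solution there are many zeros. -/
theorem IsSolFamily.exists_forall_small_hasZeros {m A : ℝ} {Z Y : ℝ → ℝ → ℝ}
    (F : IsSolFamily m A Z Y) {n : ℕ} (hm : ((n : ℝ) + 1) * (n + 2) < m) :
    ∃ ε > 0, ∀ a, a ≠ 0 → |a| ≤ ε → HasZeros (Z a) (n + 2) := by
  obtain ⟨κ, hκ, hκm⟩ := exists_between hm
  have hκ0 : 0 < κ := lt_of_le_of_lt (by positivity) hκ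
  obtain ⟨T, hT⟩ := exists_forall_hasZeros hκ
  obtain ⟨C, hC⟩ := F.lipschitz_Z T
  set η : ℝ := m / κ - 1 with hη
  have hη0 : 0 < η := by rw [hη, sub_pos, one_lt_div hκ0]; exact hκm
  have hC' : 0 < |C| + 1 := by positivity
  refine ⟨η / (|C| + 1), by positivity, fun a ha hle => ?_⟩
  refine hT (Z a) (Y a) (fun t => m * (Real.exp (Z a t) - 1)) ?_
  have hsol := F.sol a
  exact
    { hasDerivAt_Z := hsol.hasDerivAt_Z
      hasDerivAt_Y := hsol.hasDerivAt_Y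
      mul_nonneg := fun t => by
        have := mul_nonneg F.pos_m.le (mul_exp_sub_one_nonneg (Z a t))
        linarith
      le_mul := fun t ht => by
        have h1 := hC t ht a 0
        rw [F.zero_Z, sub_zero, sub_zero] at h1
        have h2 : |Z a t| ≤ η := by
          refine h1.trans ((mul_le_mul_of_nonneg_right ?_ (abs_nonneg a)).trans
            ((le_div_iff₀' hC').1 hle))
          linarith [le_abs_self C]
        have h3 := mul_le_mul_of_nonneg_left (sq_le_mul_exp_sub_one h2) hκ0.le
        have h4 : κ * (1 + η) = m := by rw [hη]; field_simp; ring
        have h5 : κ * ((1 + η) * (Z a t * (Real.exp (Z a t) - 1))) =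
            κ * (1 + η) * (Z a t * (Real.exp (Z a t) - 1)) := by ring
        rw [h5, h4] at h3
        linarith
      tendsto_Z := ⟨_, F.min_ne_zero ha, hsol.tendsto_Z⟩
      tendsto_Y := hsol.tendsto_Y }

lemma isSolFamily_of_profiles {m A : ℝ} (hm : 0 < m) (hA : 0 < A) {U V : ℝ → ℝ → ℝ} {K : ℝ → ℝ}
    (hprof : ∀ a ≤ A, IsProfile m a (U a) (V a))
    (hK : ∀ x y, 0 ≤ x → x ≤ y → K x ≤ K y)
    (hU : ∀ a a' x, |U a x - U a' x| ≤ |a - a'| * K x)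
    (hV : ∀ a a' x, |V a x - V a' x| ≤ |a - a'| * K x)
    (hU0 : ∀ x, U 0 x = -(m * Real.log (1 + |x|))) :
    IsSolFamily m A (fun a => logProfile m (U (min a A))) (fun a => logSlope m (V (min a A))) where
  pos_m := hm
  pos_A := hA
  sol a := (hprof _ (min_le_right a A)).isRegularSol
  lipschitz_Z T := by
    refine ⟨K (Real.exp (2 * T)), fun t ht a a' => ?_⟩
    have h1 := hU (min a A) (min a' A) (Real.exp (2 * t))
    have h2 := abs_min_sub_min_le_max a A a' A
    rw [sub_self, abs_zero, max_eq_left (abs_nonneg _)] at h2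
    have h3 : K (Real.exp (2 * t)) ≤ K (Real.exp (2 * T)) :=
      hK _ _ (Real.exp_pos _).le (Real.exp_le_exp.2 (by linarith))
    have h4 := (abs_nonneg _).trans (hU 1 0 (Real.exp (2 * t)))
    simp only [sub_zero, abs_one, one_mul] at h4
    unfold logProfile
    rw [add_sub_add_right_eq_sub]
    exact h1.trans ((mul_le_mul h2 h3 h4 (abs_nonneg _)).trans_eq (mul_comm _ _))
  lipschitz_Y T := by
    refine ⟨2 * Real.exp (2 * T) * K (Real.exp (2 * T)), fun t ht a a' => ?_⟩
    have h1 := hV (min a A) (min a' A) (Real.exp (2 * t))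
    have h2 := abs_min_sub_min_le_max a A a' A
    rw [sub_self, abs_zero, max_eq_left (abs_nonneg _)] at h2
    have he : Real.exp (2 * t) ≤ Real.exp (2 * T) := Real.exp_le_exp.2 (by linarith)
    have h3 : K (Real.exp (2 * t)) ≤ K (Real.exp (2 * T)) := hK _ _ (Real.exp_pos _).le he
    have h4 := (abs_nonneg _).trans (hU 1 0 (Real.exp (2 * t)))
    simp only [sub_zero, abs_one, one_mul] at h4
    have h5 : logSlope m (V (min a A)) t - logSlope m (V (min a' A)) t =
        2 * Real.exp (2 * t) *
          (V (min a A) (Real.exp (2 * t)) - V (min a' A) (Real.exp (2 * t))) := by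
      unfold logSlope; ring
    rw [h5, abs_mul, abs_of_pos (by positivity)]
    have h6 := h1.trans (mul_le_mul h2 h3 h4 (abs_nonneg _))
    refine (mul_le_mul (mul_le_mul_of_nonneg_left he two_pos.le) h6 (abs_nonneg _)
      (by positivity)).trans_eq (by ring)
  zero_Z t := by
    rw [min_eq_left hA.le, logProfile, hU0, abs_of_pos (Real.exp_pos _)]
    ring

lemma IsSolFamily.zero_Y {m A : ℝ} {Z Y : ℝ → ℝ → ℝ} (F : IsSolFamily m A Z Y) (t : ℝ) :
    Y 0 t = 0 := by
  refine ((F.sol 0).hasDerivAt_Z t).unique ?_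
  rw [show Z 0 = fun _ => (0 : ℝ) from funext F.zero_Z]
  exact hasDerivAt_const t 0

lemma HasZeros.eq_of_not {f : ℝ → ℝ} {n n' : ℕ} (h : HasZeros f n) (h1 : ¬HasZeros f (n + 1))
    (h' : HasZeros f n') (h1' : ¬HasZeros f (n' + 1)) : n = n' := by
  by_contra hne
  rcases Nat.lt_or_gt_of_ne hne with hlt | hlt
  · exact h1 (h'.mono hlt)
  · exact h1' (h.mono hlt)

/-- The initial values with bounded slope, distinguished by their sign and their number of
zeros. -/
theorem IsSolFamily.exists_injective {m A : ℝ} {Z Y : ℝ → ℝ → ℝ} (F : IsSolFamily m A Z Y) {k : ℕ}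
    (hk : 2 ≤ k) (hm : (k : ℝ) * (k + 1) < m) (hA : 2 * Real.log 2 + m * Real.log (1 + m) < A) :
    ∃ α : Fin (2 * (k - 2) + 2) → ℝ, Function.Injective α ∧ (∃ i, α i = 0) ∧
      ∀ i, α i ≤ A ∧ Tendsto (Y (α i)) atTop (nhds 0) := by
  have hk2 : (2 : ℝ) ≤ k := by exact_mod_cast hk
  have hm2 : 2 < m := by nlinarith
  have hsmall : ∃ ε > 0, ∀ a, a ≠ 0 → |a| ≤ ε → HasZeros (Z a) (k + 1) := by
    obtain ⟨n, rfl⟩ : ∃ n, k = n + 1 := ⟨k - 1, by omega⟩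
    refine F.exists_forall_small_hasZeros (n := n) (lt_of_eq_of_lt ?_ hm)
    push_cast; ring
  obtain ⟨ε, hε, hsmall⟩ := hsmall
  have hApos := F.pos_A
  have hpos : ∀ n, 3 ≤ n → n ≤ k → ∃ a, 0 < a ∧ a ≤ A ∧ HasZeros (Z a) n ∧
      ¬HasZeros (Z a) (n + 1) ∧ Tendsto (Y a) atTop (nhds 0) := by
    intro n hn hnk
    have hs0 : 0 < min ε A := lt_min hε hApos
    have h0 : (0 : ℝ) ∉ uIcc A (min ε A) := by
      rw [uIcc_of_ge (min_le_right ε A)]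
      exact fun h => absurd h.1 (not_le.2 hs0)
    have hs := (hsmall (min ε A) hs0.ne' (by
      rw [abs_of_pos hs0]; exact min_le_left _ _)).mono (show n + 1 ≤ k + 1 by omega)
    have hsol := F.sol A
    rw [min_self] at hsol
    have hp : ¬HasZeros (Z A) (n + 1) := fun h =>
      hsol.not_hasZeros_four_of_ge hm2 hA (h.mono (by omega))
    obtain ⟨a, ha, h⟩ := F.exists_tendsto_slope_zero h0 hs hp
    rw [uIcc_of_ge (min_le_right ε A)] at ha
    exact ⟨a, hs0.trans_le ha.1, ha.2, h⟩
  have hneg : ∀ n, 2 ≤ n → n ≤ k → ∃ a, a < 0 ∧ HasZeros (Z a) n ∧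
      ¬HasZeros (Z a) (n + 1) ∧ Tendsto (Y a) atTop (nhds 0) := by
    intro n hn hnk
    have hlog : 0 < Real.log (1 + m) := Real.log_pos (by linarith)
    have hB : 0 < m * Real.log (1 + m) := mul_pos F.pos_m hlog
    set p := -(m * Real.log (1 + m)) - 1 - ε with hp_def
    have hle : p ≤ -ε := by linarith
    have h0 : (0 : ℝ) ∉ uIcc p (-ε) := by
      rw [uIcc_of_le hle]
      exact fun h => absurd h.2 (by linarith)
    have hs := (hsmall (-ε) (by linarith) (by
      rw [abs_neg, abs_of_pos hε])).mono (show n + 1 ≤ k + 1 by omega)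
    have hsol := F.sol p
    rw [min_eq_left (by linarith)] at hsol
    have hp : ¬HasZeros (Z p) (n + 1) := fun h =>
      hsol.not_hasZeros_three_of_le F.pos_m (by linarith) (h.mono (by omega))
    obtain ⟨a, ha, h⟩ := F.exists_tendsto_slope_zero h0 hs hp
    rw [uIcc_of_le hle] at ha
    exact ⟨a, by linarith [ha.2], h⟩
  have hall : ∀ i : Fin (2 * (k - 2) + 2), ∃ a, a ≤ A ∧ Tendsto (Y a) atTop (nhds 0) ∧
      (i.val = 0 → a = 0) ∧
      (1 ≤ i.val → i.val < k → a < 0 ∧ HasZeros (Z a) (i + 1) ∧ ¬HasZeros (Z a) (i + 2)) ∧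
      (k ≤ i.val → 0 < a ∧ HasZeros (Z a) (i - k + 3) ∧ ¬HasZeros (Z a) (i - k + 4)) := by
    intro i
    have hi := i.isLt
    rcases Nat.eq_zero_or_pos i.val with h | h
    · refine ⟨0, hApos.le, ?_, fun _ => rfl, fun h' => by omega, fun h' => by omega⟩
      rw [show Y 0 = fun _ => (0 : ℝ) from funext F.zero_Y]
      exact tendsto_const_nhds
    rcases lt_or_ge i.val k with h' | h'
    · obtain ⟨a, h1, h2, h3, h4⟩ := hneg (i + 1) (by omega) (by omega)
      exact ⟨a, h1.le.trans hApos.le, h4, fun _ => by omega, fun _ _ => ⟨h1, h2, h3⟩,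
        fun _ => by omega⟩
    · obtain ⟨a, h1, h2, h3, h4, h5⟩ := hpos (i - k + 3) (by omega) (by omega)
      exact ⟨a, h2, h5, fun _ => by omega, fun _ _ => by omega, fun _ => ⟨h1, h3, h4⟩⟩
  choose α hαA hαY hα0 hαn hαp using hall
  refine ⟨α, fun i j hij => ?_, ⟨⟨0, by omega⟩, hα0 _ rfl⟩, fun i => ⟨hαA i, hαY i⟩⟩
  have hcase : ∀ i : Fin (2 * (k - 2) + 2),
      i.val = 0 ∨ (1 ≤ i.val ∧ i.val < k) ∨ k ≤ i.val := fun i => by omega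
  apply Fin.ext
  rcases hcase i with hi | ⟨hi, hi'⟩ | hi <;> rcases hcase j with hj | ⟨hj, hj'⟩ | hj
  · omega
  · have h1 := hα0 i hi
    have h2 := (hαn j hj hj').1
    linarith
  · have h1 := hα0 i hi
    have h2 := (hαp j hj).1
    linarith
  · have h1 := hα0 j hj
    have h2 := (hαn i hi hi').1
    linarith
  · obtain ⟨-, h1, h2⟩ := hαn i hi hi'
    obtain ⟨-, h3, h4⟩ := hαn j hj hj'
    rw [hij] at h1 h2
    have := h1.eq_of_not h2 h3 h4
    omega
  · have h1 := (hαp j hj).1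
    have h2 := (hαn i hi hi').1
    linarith
  · have h1 := hα0 j hj
    have h2 := (hαp i hi).1
    linarith
  · have h1 := (hαp i hi).1
    have h2 := (hαn j hj hj').1
    linarith
  · obtain ⟨-, h1, h2⟩ := hαp i hi
    obtain ⟨-, h3, h4⟩ := hαp j hj
    rw [hij] at h1 h2
    have := h1.eq_of_not h2 h3 h4
    omega

/-- For every integer `k ≥ 2` and every real `N > k(k+1) − 2`, there are at least
`2(k−2)+2` pairwise distinct radial solutions at level `N+2`, one of which is the
explicit solution `u*_N`. -/
theorem multiplicity_at_level_N_plus_two (k : ℕ) (hk : 2 ≤ k) (N : ℝ)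
    (hN : (k : ℝ) * ((k : ℝ) + 1) - 2 < N) :
    ∃ v : Fin (2 * (k - 2) + 2) → ℝ → ℝ,
      (∀ i, IsSolLevelN2 N (v i)) ∧
      (∀ i j, i ≠ j → ¬ EqOn (v i) (v j) (Ici 0)) ∧
      (∃ i, ∀ r : ℝ, 0 ≤ r → v i r = ustar N r) := by
  have hk2 : (2 : ℝ) ≤ k := by exact_mod_cast hk
  have hN0 : 0 < N := by nlinarith
  have hlog : 0 < Real.log (1 + (N + 2)) := Real.log_pos (by linarith)
  have hlog2 : 0 < Real.log 2 := Real.log_pos one_lt_two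
  have hB : 0 < (N + 2) * Real.log (1 + (N + 2)) := mul_pos (by linarith) hlog
  obtain ⟨A, hA⟩ := exists_gt (2 * Real.log 2 + (N + 2) * Real.log (1 + (N + 2)))
  have hA0 : 0 < A := by linarith
  obtain ⟨U, V, K, hprof, hK, hU, hV, hU0⟩ :=
    exists_profile_family (show 2 < N + 2 by linarith) hA0.le
  have F := isSolFamily_of_profiles (show 0 < N + 2 by linarith) hA0 hprof hK hU hV hU0
  obtain ⟨α, hα, ⟨i₀, hi₀⟩, h⟩ := F.exists_injective hk (by linarith) hA
  refine ⟨fun i => profileSol (N + 2) (U (α i)), fun i => ?_, fun i j hij heq => hij (hα ?_),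
    i₀, fun r _ => ?_⟩
  · have hlim := (h i).2
    rw [min_eq_left (h i).1] at hlim
    exact (hprof _ (h i).1).isSolLevelN2 hN0 hlim
  · have h0 := heq (self_mem_Ici (a := (0 : ℝ)))
    simp only [profileSol, ne_eq, OfNat.ofNat_ne_zero, not_false_eq_true, zero_pow,
      (hprof _ (h i).1).U_zero, (hprof _ (h j).1).U_zero] at h0
    linarith
  · simp only [hi₀]
    exact ustar_eq_profileSol hN0 hU0 r
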